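/- arXiv:2010.07918 — 3 statements merged into one kernel-verified Lean document; each statement's English description precedes it below -/
import Mathlib

section
/- Suppose in addition that the graded families 𝕀, 𝕁(1), …, 𝕁(r) are Noetherian (their Rees algebras ⊕_n I_n t^n, ⊕_n J(i)_n t^n ⊆ R[t] are Noetherian rings). Fix n_0 ∈ ℕ, 𝐧 ∈ ℕ^r and ε > 0. Then there exists p_0 ∈ ℕ such that for all p ≥ p_0: Vol_d(Δ(Γ_{n_0,𝐧})) ≥ H_p(n_0,𝐧) ≥ Vol_d(Δ(Γ_{n_0,𝐧})) − ε, and Vol_d(Δ(Γ̂_{n_0,𝐧})) ≥ Ĥ_p(n_0,𝐧) ≥ Vol_d(Δ(Γ̂_{n_0,𝐧})) − ε, where H_p(n_0,𝐧) = lim_{m→∞} dim_𝕜( 𝐉(p)^{m𝐧} / (𝔪^{cmp(n_0+|𝐧|)+1} ∩ 𝐉(p)^{m𝐧}) ) / (m^d p^d) and Ĥ_p(n_0,𝐧) = lim_{m→∞} dim_𝕜( I_p^{m n_0}𝐉(p)^{m𝐧} / (𝔪^{cmp(n_0+|𝐧|)+1} ∩ I_p^{m n_0}𝐉(p)^{m𝐧})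 ) / (m^d p^d), with 𝐉(p)^𝐧 = J(1)_p^{n_1}⋯J(r)_p^{n_r} (these limits exist). -/
open Filter MvPolynomial Pointwise MeasureTheory

noncomputable section

/-- The graded irrelevant (maximal graded) ideal `𝔪 = (x_1, …, x_d)` of `𝕜[x_1, …, x_d]`. -/
def mId (𝕜 : Type*) [Field 𝕜] (d : ℕ) : Ideal (MvPolynomial (Fin d) 𝕜) :=
  Ideal.span (Set.range MvPolynomial.X)

/-- A graded family of ideals: `I 0 = R` and `I i * I j ⊆ I (i + j)`. -/
def IsGradedFamily {R : Type*} [CommSemiring R] (I : ℕ → Ideal R) : Prop :=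
  I 0 = ⊤ ∧ ∀ i j : ℕ, I i * I j ≤ I (i + j)

/-- An `𝔪`-primary ideal of the polynomial ring: a proper ideal containing a power of `𝔪`. -/
def IsMPrimary {𝕜 : Type*} [Field 𝕜] {d : ℕ} (I : Ideal (MvPolynomial (Fin d) 𝕜)) : Prop :=
  I ≠ ⊤ ∧ ∃ k : ℕ, mId 𝕜 d ^ k ≤ I

/-- A monomial ideal: an ideal generated by monomials. -/
def IsMonomialIdeal {𝕜 : Type*} [Field 𝕜] {d : ℕ} (I : Ideal (MvPolynomial (Fin d) 𝕜)) : Prop :=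
  ∃ S : Set (Fin d →₀ ℕ), I = Ideal.span ((fun m => MvPolynomial.monomial m (1 : 𝕜)) '' S)

/-- A nonzero monomial ideal generated by monomials of degree at most `b`;
for nonzero monomial ideals this is exactly the condition `β(I) ≤ b`. -/
def IsMonomialBounded {𝕜 : Type*} [Field 𝕜] {d : ℕ} (I : Ideal (MvPolynomial (Fin d) 𝕜))
    (b : ℕ) : Prop :=
  I ≠ ⊥ ∧ ∃ S : Set (Fin d →₀ ℕ), (∀ m ∈ S, (∑ j, m j) ≤ b) ∧
    I = Ideal.span ((fun m => MvPolynomial.monomial m (1 : 𝕜)) '' S)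

/-- The `𝕜`-vector space dimension of the quotient `A / (A ⊓ B)`; for `B ⊆ A`
this is `dim_𝕜 (A / B)`. -/
def quotDim (𝕜 : Type*) [Field 𝕜] {R : Type*} [CommRing R] [Algebra 𝕜 R]
    (A B : Ideal R) : ℕ :=
  Module.finrank 𝕜
    (↥(Submodule.restrictScalars 𝕜 A) ⧸
      Submodule.comap (Submodule.restrictScalars 𝕜 A).subtype (Submodule.restrictScalars 𝕜 B))

/-- The semigroup `Γ_{n₀,𝐧} = {(𝐦,m) ∈ ℕ^d × ℕ : x^𝐦 ∈ 𝐉_{m𝐧}, |𝐦| ≤ c m (n₀+|𝐧|)}`. -/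
def GammaSet (𝕜 : Type*) [Field 𝕜] {d r : ℕ}
    (J : Fin r → ℕ → Ideal (MvPolynomial (Fin d) 𝕜)) (c n0 : ℕ) (n : Fin r → ℕ) :
    Set ((Fin d →₀ ℕ) × ℕ) :=
  {q | MvPolynomial.monomial q.1 (1 : 𝕜) ∈ ∏ i, J i (q.2 * n i) ∧
    (∑ j, q.1 j) ≤ c * q.2 * (n0 + ∑ i, n i)}

/-- The semigroup `Γ̂_{n₀,𝐧} = {(𝐦,m) : x^𝐦 ∈ I_{m n₀}𝐉_{m𝐧}, |𝐦| ≤ c m (n₀+|𝐧|)}`. -/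
def GammaHatSet (𝕜 : Type*) [Field 𝕜] {d r : ℕ}
    (I : ℕ → Ideal (MvPolynomial (Fin d) 𝕜))
    (J : Fin r → ℕ → Ideal (MvPolynomial (Fin d) 𝕜)) (c n0 : ℕ) (n : Fin r → ℕ) :
    Set ((Fin d →₀ ℕ) × ℕ) :=
  {q | MvPolynomial.monomial q.1 (1 : 𝕜) ∈ I (q.2 * n0) * ∏ i, J i (q.2 * n i) ∧
    (∑ j, q.1 j) ≤ c * q.2 * (n0 + ∑ i, n i)}

/-- The level set `π₁([S]_m)` of a subset `S ⊆ ℕ^d × ℕ`. -/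
def levelSet {d : ℕ} (S : Set ((Fin d →₀ ℕ) × ℕ)) (m : ℕ) : Set (Fin d →₀ ℕ) :=
  {q | (q, m) ∈ S}

/-- The embedding `ℕ^d × ℕ → ℝ^d × ℝ`. -/
def embedReal {d : ℕ} (q : (Fin d →₀ ℕ) × ℕ) : (Fin d → ℝ) × ℝ :=
  ((fun j => (q.1 j : ℝ)), (q.2 : ℝ))

/-- `Con(S)`: the closure of the set of all non-negative real linear combinations of
elements of `S ⊆ ℝ^d × ℝ`. -/
def coneOf {d : ℕ} (S : Set ((Fin d → ℝ) × ℝ)) : Set ((Fin d → ℝ) × ℝ) :=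
  closure {x | ∃ (k : ℕ) (a : Fin k → ℝ) (v : Fin k → (Fin d → ℝ) × ℝ),
    (∀ j, 0 ≤ a j) ∧ (∀ j, v j ∈ S) ∧ x = ∑ j, a j • v j}

/-- The Newton–Okounkov body `Δ(S) = Con(S) ∩ π^{-1}(1)` of `S ⊆ ℕ^d × ℕ`,
where `π` is the projection to the last coordinate. -/
def newtonBody {d : ℕ} (S : Set ((Fin d →₀ ℕ) × ℕ)) : Set ((Fin d → ℝ) × ℝ) :=
  {x | x ∈ coneOf (embedReal '' S) ∧ x.2 = 1}

/-- `Vol_d(Δ(S))`: the `d`-dimensional Lebesgue volume of `π₁(Δ(S))`. -/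
def volDelta {d : ℕ} (S : Set ((Fin d →₀ ℕ) × ℕ)) : ℝ :=
  (MeasureTheory.volume (Prod.fst '' newtonBody S)).toReal

/-- A graded family is Noetherian when its Rees algebra `⊕ₙ Iₙ tⁿ ⊆ R[t]` (the `R`-subalgebra
of `R[t]` generated by the elements `x tⁿ`, `x ∈ Iₙ`) is a Noetherian ring. -/
def FamilyNoetherian {R : Type*} [CommRing R] (I : ℕ → Ideal R) : Prop :=
  IsNoetherianRing
    (Algebra.adjoin R (⋃ n : ℕ, (fun x : R => Polynomial.C x * Polynomial.X ^ n) '' (I n : Set R)))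

section MonomialIdeals

variable {𝕜 : Type*} [Field 𝕜] {d : ℕ}

/-- The set of exponents of the monomials lying in an ideal. -/
def exps (K : Ideal (MvPolynomial (Fin d) 𝕜)) : Set (Fin d →₀ ℕ) :=
  {u | MvPolynomial.monomial u (1 : 𝕜) ∈ K}

lemma mem_exps {K : Ideal (MvPolynomial (Fin d) 𝕜)} {u : Fin d →₀ ℕ} :
    u ∈ exps K ↔ MvPolynomial.monomial u (1 : 𝕜) ∈ K := Iff.rfl

lemma add_mem_exps_mul {A B : Ideal (MvPolynomial (Fin d) 𝕜)} {u v : Fin d →₀ ℕ}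
    (hu : u ∈ exps A) (hv : v ∈ exps B) : u + v ∈ exps (A * B) := by
  have := Ideal.mul_mem_mul hu hv
  rwa [MvPolynomial.monomial_mul, one_mul] at this

lemma add_mem_exps {A : Ideal (MvPolynomial (Fin d) 𝕜)} {u : Fin d →₀ ℕ}
    (hu : u ∈ exps A) (v : Fin d →₀ ℕ) : u + v ∈ exps A := by
  have := A.mul_mem_right (MvPolynomial.monomial v (1 : 𝕜)) hu
  rwa [MvPolynomial.monomial_mul, one_mul] at this

lemma exps_mono {A B : Ideal (MvPolynomial (Fin d) 𝕜)} (h : A ≤ B) : exps A ⊆ exps B :=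
  fun _ hu => h hu

lemma exps_top : exps (⊤ : Ideal (MvPolynomial (Fin d) 𝕜)) = Set.univ :=
  Set.eq_univ_of_forall fun u => by simp [exps]

lemma nsmul_mem_exps_pow {A : Ideal (MvPolynomial (Fin d) 𝕜)} {u : Fin d →₀ ℕ}
    (hu : u ∈ exps A) (k : ℕ) : k • u ∈ exps (A ^ k) := by
  induction k with
  | zero => simp [exps_top]
  | succ k ih => rw [succ_nsmul, pow_succ]; exact add_mem_exps_mul ih hu

lemma sum_nsmul_mem_exps_pow {ι : Type*} (s : Finset ι) {A : Ideal (MvPolynomial (Fin d) 𝕜)}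
    (u : ι → (Fin d →₀ ℕ)) (k : ι → ℕ) (hu : ∀ i ∈ s, u i ∈ exps A) :
    (∑ i ∈ s, k i • u i : Fin d →₀ ℕ) ∈ exps (A ^ ∑ i ∈ s, k i) := by
  classical
  induction s using Finset.induction_on with
  | empty => simp [exps_top]
  | insert i s hi ih =>
    rw [Finset.sum_insert hi, Finset.sum_insert hi, pow_add]
    exact add_mem_exps_mul (nsmul_mem_exps_pow (hu i (by simp)) _)
      (ih fun j hj => hu j (Finset.mem_insert_of_mem hj))

lemma IsMonomialIdeal.mem_iff {K : Ideal (MvPolynomial (Fin d) 𝕜)} (hK : IsMonomialIdeal K)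
    {f : MvPolynomial (Fin d) 𝕜} : f ∈ K ↔ ∀ u ∈ f.support, u ∈ exps K := by
  obtain ⟨S, rfl⟩ := hK
  have key : ∀ u : Fin d →₀ ℕ, u ∈ exps (Ideal.span
      ((fun m => MvPolynomial.monomial m (1 : 𝕜)) '' S)) ↔ ∃ s ∈ S, s ≤ u := by
    intro u
    rw [mem_exps, MvPolynomial.mem_ideal_span_monomial_image]
    classical
    simp [MvPolynomial.support_monomial]
  rw [MvPolynomial.mem_ideal_span_monomial_image]
  simp only [key]

lemma isMonomialIdeal_top : IsMonomialIdeal (⊤ : Ideal (MvPolynomial (Fin d) 𝕜)) :=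
  ⟨{0}, by
    rw [Set.image_singleton, eq_comm, Ideal.eq_top_iff_one]
    exact Ideal.subset_span rfl⟩

lemma mul_span_monomial (S T : Set (Fin d →₀ ℕ)) :
    Ideal.span ((fun m => MvPolynomial.monomial m (1 : 𝕜)) '' S) *
      Ideal.span ((fun m => MvPolynomial.monomial m (1 : 𝕜)) '' T) =
      Ideal.span ((fun m => MvPolynomial.monomial m (1 : 𝕜)) '' (S + T)) := by
  rw [Ideal.span_mul_span]
  congr 1
  ext f
  simp only [Set.mem_mul, Set.mem_image, Set.mem_add]
  constructor
  · rintro ⟨_, ⟨a, ha, rfl⟩, _, ⟨b, hb, rfl⟩, rfl⟩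
    exact ⟨_, ⟨a, ha, b, hb, rfl⟩, by simp [MvPolynomial.monomial_mul]⟩
  · rintro ⟨_, ⟨a, ha, b, hb, rfl⟩, rfl⟩
    exact ⟨_, ⟨a, ha, rfl⟩, _, ⟨b, hb, rfl⟩, by simp [MvPolynomial.monomial_mul]⟩

lemma IsMonomialIdeal.mul {A B : Ideal (MvPolynomial (Fin d) 𝕜)} (hA : IsMonomialIdeal A)
    (hB : IsMonomialIdeal B) : IsMonomialIdeal (A * B) := by
  obtain ⟨S, rfl⟩ := hA
  obtain ⟨T, rfl⟩ := hB
  exact ⟨S + T, mul_span_monomial S T⟩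

lemma IsMonomialIdeal.pow {A : Ideal (MvPolynomial (Fin d) 𝕜)} (hA : IsMonomialIdeal A) (k : ℕ) :
    IsMonomialIdeal (A ^ k) := by
  induction k with
  | zero => rw [pow_zero, Ideal.one_eq_top]; exact isMonomialIdeal_top
  | succ k ih => rw [pow_succ]; exact ih.mul hA

lemma IsMonomialIdeal.prod {ι : Type*} (s : Finset ι) {A : ι → Ideal (MvPolynomial (Fin d) 𝕜)}
    (hA : ∀ i, IsMonomialIdeal (A i)) : IsMonomialIdeal (∏ i ∈ s, A i) :=
  Finset.prod_induction _ IsMonomialIdeal (fun _ _ ha hb => ha.mul hb)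
    (by rw [Ideal.one_eq_top]; exact isMonomialIdeal_top) fun i _ => hA i

lemma exists_add_of_mem_exps_mul {A B : Ideal (MvPolynomial (Fin d) 𝕜)} (hA : IsMonomialIdeal A)
    (hB : IsMonomialIdeal B) {u : Fin d →₀ ℕ} (hu : u ∈ exps (A * B)) :
    ∃ a ∈ exps A, ∃ b ∈ exps B, a + b = u := by
  obtain ⟨S, rfl⟩ := hA
  obtain ⟨T, rfl⟩ := hB
  rw [mul_span_monomial, mem_exps, MvPolynomial.mem_ideal_span_monomial_image] at hu
  classical
  obtain ⟨_, ⟨a, ha, b, hb, rfl⟩, hle⟩ := hu u (by simp [MvPolynomial.support_monomial])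
  obtain ⟨w, rfl⟩ := exists_add_of_le hle
  refine ⟨a, ?_, b + w, add_mem_exps ?_ w, by simp [add_assoc]⟩
  · exact Ideal.subset_span (Set.mem_image_of_mem _ ha)
  · exact Ideal.subset_span (Set.mem_image_of_mem _ hb)

lemma IsMonomialIdeal.exps_nonempty {A : Ideal (MvPolynomial (Fin d) 𝕜)}
    (hA : IsMonomialIdeal A) (h : A ≠ ⊥) : (exps A).Nonempty := by
  obtain ⟨f, hf, hf0⟩ := Submodule.exists_mem_ne_zero_of_ne_bot h
  obtain ⟨u, hu⟩ := MvPolynomial.support_nonempty.2 hf0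
  exact ⟨u, hA.mem_iff.1 hf u hu⟩

lemma finite_setOf_sum_le (N : ℕ) : {u : Fin d →₀ ℕ | ∑ j, u j ≤ N}.Finite := by
  refine ((Set.finite_Iic (Finsupp.equivFunOnFinite.symm fun _ : Fin d => N))).subset ?_
  intro u hu j
  exact (Finset.single_le_sum (fun _ _ => Nat.zero_le _) (Finset.mem_univ j)).trans hu

/-- The dimension of `A / (A ∩ 𝔪^(N+1))` counts the monomials of degree at most `N` in `A`. -/
lemma quotDim_eq_ncard {A : Ideal (MvPolynomial (Fin d) 𝕜)} (hA : IsMonomialIdeal A) (N : ℕ) :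
    quotDim 𝕜 A (mId 𝕜 d ^ (N + 1) ⊓ A) = {u | u ∈ exps A ∧ ∑ j, u j ≤ N}.ncard := by
  classical
  set S : Set (Fin d →₀ ℕ) := {u | u ∈ exps A ∧ ∑ j, u j ≤ N} with hS
  have hfin : S.Finite := (finite_setOf_sum_le N).subset fun u hu => hu.2
  have : Fintype S := hfin.fintype
  let φ : ↥(Submodule.restrictScalars 𝕜 A) →ₗ[𝕜] (S → 𝕜) :=
    (LinearMap.pi fun u : S => MvPolynomial.lcoeff 𝕜 u.1) ∘ₗ
      (Submodule.restrictScalars 𝕜 A).subtype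
  have hφ : ∀ f u, φ f u = MvPolynomial.coeff u.1 f.1 := fun f u => rfl
  have hker : Submodule.comap (Submodule.restrictScalars 𝕜 A).subtype
      (Submodule.restrictScalars 𝕜 (mId 𝕜 d ^ (N + 1) ⊓ A)) = LinearMap.ker φ := by
    ext ⟨f, hf⟩
    have hf' : f ∈ A := hf
    simp only [Submodule.mem_comap, Submodule.subtype_apply, Submodule.restrictScalars_mem,
      Submodule.mem_inf, LinearMap.mem_ker, hf', and_true]
    have h1 := MvPolynomial.mem_pow_idealOfVars_iff' (σ := Fin d) (R := 𝕜) (N + 1) f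
    change f ∈ mId 𝕜 d ^ (N + 1) ↔ _ at h1
    rw [h1]
    constructor
    · intro h
      ext u
      rw [hφ]
      exact h u.1 (by rw [Finsupp.degree_eq_sum]; exact Nat.lt_succ_of_le u.2.2)
    · intro h u hu
      by_contra hne
      have hu' : u ∈ S := ⟨hA.mem_iff.1 hf' u (MvPolynomial.mem_support_iff.2 hne), by
        rw [Finsupp.degree_eq_sum] at hu; exact Nat.le_of_lt_succ hu⟩
      exact hne (congrFun h ⟨u, hu'⟩)
  have hsurj : Function.Surjective φ := by
    intro g
    refine ⟨⟨∑ u : S, MvPolynomial.monomial u.1 (g u), ?_⟩, ?_⟩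
    · refine Submodule.sum_mem _ fun u _ => ?_
      have := A.mul_mem_left (MvPolynomial.C (g u)) u.2.1
      rwa [MvPolynomial.C_mul_monomial, mul_one] at this
    · ext v
      rw [hφ]
      simp [MvPolynomial.coeff_sum, MvPolynomial.coeff_monomial, Subtype.coe_inj]
  unfold quotDim
  rw [hker, (φ.quotKerEquivOfSurjective hsurj).finrank_eq, Module.finrank_fintype_fun_eq_card,
    Set.ncard_eq_toFinset_card', Set.toFinset_card]

end MonomialIdeals

section Lattice

variable {d : ℕ}

/-- The real vector attached to an exponent vector. -/
def toR (u : Fin d →₀ ℕ) : Fin d → ℝ := fun j => (u j : ℝ)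

lemma toR_apply (u : Fin d →₀ ℕ) (j : Fin d) : toR u j = u j := rfl

lemma toR_nonneg (u : Fin d →₀ ℕ) : 0 ≤ toR u := fun _ => Nat.cast_nonneg _

lemma toR_add (u v : Fin d →₀ ℕ) : toR (u + v) = toR u + toR v := by
  ext j; simp [toR]

lemma toR_injective : Function.Injective (toR (d := d)) := by
  intro u v h
  ext j
  exact Nat.cast_injective (R := ℝ) (congrFun h j)

lemma Convex.volume_real_closure {s : Set (Fin d → ℝ)} (hs : Convex ℝ s) :
    volume.real (closure s) = volume.real s := by
  rw [measureReal_def, measureReal_def,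
    measure_closure_of_null_frontier (hs.addHaar_frontier volume)]

lemma Convex.volume_interior {s : Set (Fin d → ℝ)} (hs : Convex ℝ s) :
    volume (interior s) = volume s :=
  measure_interior_of_null_frontier (hs.addHaar_frontier volume)

lemma finite_setOf_smul_toR_mem {s : Set (Fin d → ℝ)} (hb : Bornology.IsBounded s) {m : ℕ}
    (hm : 0 < m) : {u : Fin d →₀ ℕ | (m : ℝ)⁻¹ • toR u ∈ s}.Finite := by
  obtain ⟨R, hR⟩ := hb.subset_closedBall 0
  refine (finite_setOf_sum_le (d := d) (d * ⌈(m : ℝ) * R⌉₊)).subset ?_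
  intro u hu
  have h1 : ‖(m : ℝ)⁻¹ • toR u‖ ≤ R := by simpa using hR hu
  have hm' : (0 : ℝ) < m := by exact_mod_cast hm
  have h2 : ∀ j, u j ≤ ⌈(m : ℝ) * R⌉₊ := by
    intro j
    have h3 := (norm_le_pi_norm _ j).trans h1
    simp only [Pi.smul_apply, toR_apply, smul_eq_mul, norm_mul, norm_inv, Real.norm_natCast] at h3
    rw [inv_mul_le_iff₀ hm'] at h3
    exact_mod_cast h3.trans (Nat.le_ceil _)
  calc ∑ j, u j ≤ ∑ _j : Fin d, ⌈(m : ℝ) * R⌉₊ := Finset.sum_le_sum fun j _ => h2 j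
    _ = _ := by simp

lemma tendsto_ncard_of_measurable {s : Set (Fin d → ℝ)} (hb : Bornology.IsBounded s)
    (h0 : ∀ x ∈ s, 0 ≤ x) (hm : MeasurableSet s) (hf : volume (frontier s) = 0) :
    Tendsto (fun m : ℕ => ({u : Fin d →₀ ℕ | (m : ℝ)⁻¹ • toR u ∈ s}.ncard : ℝ) / (m : ℝ) ^ d)
      atTop (nhds (volume.real s)) := by
  have h := tendsto_card_div_pow_atTop_volume s hb hm hf
  rw [Fintype.card_fin] at h
  refine h.congr' ?_
  filter_upwards [eventually_gt_atTop 0] with m hm0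
  have hm' : (0 : ℝ) < m := by exact_mod_cast hm0
  congr 2
  change Set.ncard _ = _
  have hinj : Function.Injective fun u : Fin d →₀ ℕ => (m : ℝ)⁻¹ • toR u :=
    (smul_right_injective _ (inv_ne_zero hm'.ne')).comp toR_injective
  rw [← Set.ncard_image_of_injective _ hinj]
  congr 1
  ext x
  simp only [Set.mem_inter_iff, Set.mem_image, Set.mem_ofPred_eq]
  constructor
  · rintro ⟨hx, y, hy, rfl⟩
    have hy' : ∀ j, ∃ z : ℤ, (z : ℝ) = y j := by
      have := (Module.Basis.mem_span_iff_repr_mem ℤ (Pi.basisFun ℝ (Fin d)) y).1 hy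
      intro j
      simpa using this j
    choose z hz using hy'
    have hz0 : ∀ j, 0 ≤ z j := by
      intro j
      have := h0 _ hx j
      simp only [Pi.smul_apply, smul_eq_mul, ← hz j, Pi.zero_apply] at this
      have h2 : (0 : ℝ) ≤ z j := nonneg_of_mul_nonneg_right this (inv_pos.2 hm')
      exact_mod_cast h2
    have hu : toR (Finsupp.equivFunOnFinite.symm fun j => (z j).toNat) = y := by
      ext j
      rw [toR_apply, ← hz j]
      have : (((z j).toNat : ℤ) : ℝ) = z j := by rw [Int.toNat_of_nonneg (hz0 j)]
      exact this
    exact ⟨_, by rw [hu]; exact hx, by rw [hu]⟩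
  · rintro ⟨u, hu, rfl⟩
    refine ⟨hu, Set.smul_mem_smul_set ?_⟩
    refine (Module.Basis.mem_span_iff_repr_mem ℤ (Pi.basisFun ℝ (Fin d)) _).2 fun j => ?_
    exact ⟨(u j : ℤ), by simp [toR]⟩

/-- The number of lattice points in the dilates of a bounded convex subset of the orthant. -/
lemma Convex.tendsto_ncard {s : Set (Fin d → ℝ)} (hs : Convex ℝ s) (hb : Bornology.IsBounded s)
    (h0 : ∀ x ∈ s, 0 ≤ x) :
    Tendsto (fun m : ℕ => ({u : Fin d →₀ ℕ | (m : ℝ)⁻¹ • toR u ∈ s}.ncard : ℝ) / (m : ℝ) ^ d)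
      atTop (nhds (volume.real s)) := by
  have hcl : ∀ x ∈ closure s, 0 ≤ x := fun x hx =>
    closure_minimal (fun x hx => h0 x hx) isClosed_Ici hx
  have h1 := tendsto_ncard_of_measurable (hb.subset interior_subset)
    (fun x hx => h0 x (interior_subset hx)) isOpen_interior.measurableSet
    (hs.interior.addHaar_frontier volume)
  have h2 := tendsto_ncard_of_measurable hb.closure hcl isClosed_closure.measurableSet
    (hs.closure.addHaar_frontier volume)
  rw [measureReal_def, hs.volume_interior, ← measureReal_def] at h1
  rw [hs.volume_real_closure] at h2
  refine tendsto_of_tendsto_of_tendsto_of_le_of_le' h1 h2 ?_ ?_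
  · filter_upwards [eventually_gt_atTop 0] with m hm
    gcongr
    · exact finite_setOf_smul_toR_mem hb hm
    · exact interior_subset
  · filter_upwards [eventually_gt_atTop 0] with m hm
    gcongr
    · exact finite_setOf_smul_toR_mem hb.closure hm
    · exact subset_closure

/-- The half-space of vectors whose coordinates sum to at most `b`. -/
def sumLe (d : ℕ) (b : ℝ) : Set (Fin d → ℝ) := {x | ∑ j, x j ≤ b}

lemma convex_sumLe (b : ℝ) : Convex ℝ (sumLe d b) := by
  intro x hx y hy s t hs ht hst
  change ∑ j, x j ≤ b at hx
  change ∑ j, y j ≤ b at hy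
  change ∑ j, (s * x j + t * y j) ≤ b
  rw [Finset.sum_add_distrib, ← Finset.mul_sum, ← Finset.mul_sum]
  calc s * ∑ j, x j + t * ∑ j, y j ≤ s * b + t * b := by gcongr
    _ = b := by rw [← add_mul, hst, one_mul]

lemma isBounded_of_sumLe {s : Set (Fin d → ℝ)} {b : ℝ} (h0 : ∀ x ∈ s, 0 ≤ x)
    (hb : s ⊆ sumLe d b) : Bornology.IsBounded s := by
  refine (Metric.isBounded_Icc (0 : Fin d → ℝ) fun _ => b).subset fun x hx => ⟨h0 x hx, fun j => ?_⟩
  exact (Finset.single_le_sum (fun i _ => h0 x hx i) (Finset.mem_univ j)).trans (hb hx)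

end Lattice

section Newton

variable {𝕜 : Type*} [Field 𝕜] {d : ℕ}

/-- The Newton polyhedron of an ideal: the convex hull of the exponents of its monomials. -/
def newton (K : Ideal (MvPolynomial (Fin d) 𝕜)) : Set (Fin d → ℝ) :=
  convexHull ℝ (toR '' exps K)

lemma convex_newton (K : Ideal (MvPolynomial (Fin d) 𝕜)) : Convex ℝ (newton K) :=
  convex_convexHull ℝ _

lemma toR_mem_newton {K : Ideal (MvPolynomial (Fin d) 𝕜)} {u : Fin d →₀ ℕ} (hu : u ∈ exps K) :
    toR u ∈ newton K :=
  subset_convexHull ℝ _ (Set.mem_image_of_mem _ hu)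

lemma newton_nonneg {K : Ideal (MvPolynomial (Fin d) 𝕜)} {x : Fin d → ℝ} (hx : x ∈ newton K) :
    0 ≤ x :=
  convexHull_min (t := Set.Ici (0 : Fin d → ℝ)) (by rintro _ ⟨u, -, rfl⟩; exact toR_nonneg u)
    (convex_Ici _) hx

lemma mem_convexHull_range_toR {w : Fin d → ℝ} (hw : 0 ≤ w) :
    w ∈ convexHull ℝ (Set.range (toR (d := d))) := by
  have hrange : Set.range (toR (d := d)) =
      Set.univ.pi fun _ : Fin d => Set.range (Nat.cast : ℕ → ℝ) := by
    ext x
    simp only [Set.mem_range, Set.mem_univ_pi]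
    constructor
    · rintro ⟨u, rfl⟩ j
      exact ⟨u j, rfl⟩
    · intro h
      choose u hu using h
      exact ⟨Finsupp.equivFunOnFinite.symm u, by ext j; simp [toR, hu]⟩
  rw [hrange, convexHull_pi, Set.mem_univ_pi]
  intro j
  have hseg : segment ℝ ((0 : ℕ) : ℝ) (⌈w j⌉₊ : ℝ) ⊆ convexHull ℝ (Set.range (Nat.cast : ℕ → ℝ)) :=
    segment_subset_convexHull ⟨0, rfl⟩ ⟨_, rfl⟩
  refine hseg ?_
  rw [segment_eq_Icc (Nat.cast_le.2 (Nat.zero_le _))]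
  exact ⟨by simpa using hw j, Nat.le_ceil _⟩

lemma mem_newton_of_le {K : Ideal (MvPolynomial (Fin d) 𝕜)} {x y : Fin d → ℝ} (hx : x ∈ newton K)
    (hxy : x ≤ y) : y ∈ newton K := by
  have h : x + (y - x) ∈ convexHull ℝ (toR '' exps K + Set.range (toR (d := d))) := by
    rw [convexHull_add]
    exact Set.add_mem_add hx (mem_convexHull_range_toR (sub_nonneg.2 hxy))
  rw [add_sub_cancel] at h
  refine convexHull_mono ?_ h
  rintro _ ⟨_, ⟨u, hu, rfl⟩, _, ⟨v, rfl⟩, rfl⟩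
  exact ⟨u + v, add_mem_exps hu v, toR_add u v⟩

lemma IsMonomialIdeal.toR_mem_smul_newton {K : Ideal (MvPolynomial (Fin d) 𝕜)}
    (hK : IsMonomialIdeal K) (m : ℕ) {u : Fin d →₀ ℕ} (hu : u ∈ exps (K ^ (m + 1))) :
    toR u ∈ ((m + 1 : ℕ) : ℝ) • newton K := by
  induction m generalizing u with
  | zero =>
    rw [zero_add, pow_one] at hu
    simpa using toR_mem_newton hu
  | succ m ih =>
    rw [pow_succ] at hu
    obtain ⟨a, ha, b, hb, rfl⟩ := exists_add_of_mem_exps_mul (hK.pow _) hK hu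
    rw [Nat.cast_succ (m + 1), (convex_newton K).add_smul (by positivity) zero_le_one, one_smul,
      toR_add]
    exact Set.add_mem_add (ih ha) (toR_mem_newton hb)

lemma mem_exps_pow_of_toR_mem {K : Ideal (MvPolynomial (Fin d) 𝕜)} {m : ℕ} {t : ℝ}
    (ht : (m : ℝ) + d + 1 ≤ t) {u : Fin d →₀ ℕ} (hu : toR u ∈ t • newton K) :
    u ∈ exps (K ^ m) := by
  obtain ⟨x, hx, hxu⟩ := hu
  have ht0 : 0 ≤ t := le_trans (by positivity) ht
  obtain ⟨ι, _, z, w, hz, hind, hw0, hw1, hwx⟩ := eq_pos_convex_span_of_mem_convexHull hx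
  have hz' : ∀ i, ∃ a ∈ exps K, toR a = z i := fun i => hz ⟨i, rfl⟩
  choose a ha haz using hz'
  have hcard : (Fintype.card ι : ℝ) ≤ d + 1 := by
    have h1 := hind.card_le_finrank_succ
    have h2 := Submodule.finrank_le (vectorSpan ℝ (Set.range z))
    rw [Module.finrank_fin_fun] at h2
    exact_mod_cast h1.trans (Nat.succ_le_succ h2)
  have hk : m ≤ ∑ i, ⌊t * w i⌋₊ := by
    have h1 : ∑ i, (t * w i - 1) ≤ ∑ i, (⌊t * w i⌋₊ : ℝ) :=
      Finset.sum_le_sum fun i _ => (Nat.sub_one_lt_floor _).le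
    rw [Finset.sum_sub_distrib, ← Finset.mul_sum, hw1] at h1
    simp only [Finset.sum_const, Finset.card_univ, nsmul_eq_mul, mul_one] at h1
    have h2 : (m : ℝ) ≤ ∑ i, (⌊t * w i⌋₊ : ℝ) := by linarith
    exact_mod_cast h2
  have hle : ∑ i, ⌊t * w i⌋₊ • a i ≤ u := by
    intro j
    have h1 : (u j : ℝ) = ∑ i, t * w i * a i j := by
      rw [← toR_apply, ← hxu, ← hwx]
      simp only [Pi.smul_apply, Finset.sum_apply, smul_eq_mul, Finset.mul_sum, ← haz, toR_apply,
        mul_assoc]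
    have h2 : ((∑ i, ⌊t * w i⌋₊ • a i) j : ℝ) ≤ u j := by
      rw [h1, Finsupp.finsetSum_apply]
      push_cast
      refine Finset.sum_le_sum fun i _ => ?_
      simp only [Pi.smul_apply, smul_eq_mul, Nat.cast_mul]
      exact mul_le_mul_of_nonneg_right (Nat.floor_le (mul_nonneg ht0 (hw0 i).le))
        (Nat.cast_nonneg _)
    exact_mod_cast h2
  obtain ⟨v, rfl⟩ := exists_add_of_le hle
  exact add_mem_exps (exps_mono (Ideal.pow_le_pow_right hk)
    (sum_nsmul_mem_exps_pow Finset.univ a _ fun i _ => ha i)) v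

end Newton

section Limit

variable {𝕜 : Type*} [Field 𝕜] {d : ℕ}

/-- The part of the Newton polyhedron in degrees at most `b`. -/
def truncNewton (K : Ideal (MvPolynomial (Fin d) 𝕜)) (b : ℝ) : Set (Fin d → ℝ) :=
  newton K ∩ sumLe d b

lemma convex_truncNewton (K : Ideal (MvPolynomial (Fin d) 𝕜)) (b : ℝ) :
    Convex ℝ (truncNewton K b) :=
  (convex_newton K).inter (convex_sumLe b)

lemma isBounded_truncNewton (K : Ideal (MvPolynomial (Fin d) 𝕜)) (b : ℝ) :
    Bornology.IsBounded (truncNewton K b) :=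
  isBounded_of_sumLe (fun _ hx => newton_nonneg hx.1) Set.inter_subset_right

lemma smul_newton_subset (K : Ideal (MvPolynomial (Fin d) 𝕜)) {s t : ℝ} (hs : 0 < s)
    (hst : s ≤ t) : t • newton K ⊆ s • newton K := by
  rintro _ ⟨x, hx, rfl⟩
  rw [Set.mem_smul_set_iff_inv_smul_mem₀ hs.ne']
  refine mem_newton_of_le hx fun j => ?_
  have hxj : 0 ≤ x j := newton_nonneg hx j
  simp only [Pi.smul_apply, smul_eq_mul]
  rw [le_inv_mul_iff₀ hs]
  exact mul_le_mul_of_nonneg_right hst hxj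

lemma inv_smul_toR_mem_sumLe {m : ℕ} (hm : 0 < m) {u : Fin d →₀ ℕ} {b : ℕ} :
    (m : ℝ)⁻¹ • toR u ∈ sumLe d b ↔ ∑ j, u j ≤ m * b := by
  have hm' : (0 : ℝ) < m := by exact_mod_cast hm
  change ∑ j, (m : ℝ)⁻¹ * (u j : ℝ) ≤ b ↔ _
  rw [← Finset.mul_sum, inv_mul_le_iff₀ hm']
  exact_mod_cast Iff.rfl

/-- The volumes of the slightly shrunk truncated Newton polyhedra approximate the full volume. -/
lemma tendsto_volume_smul_newton (K : Ideal (MvPolynomial (Fin d) 𝕜)) (b : ℝ) :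
    Tendsto (fun k : ℕ => volume.real (((1 + 1 / ((k : ℝ) + 1)) • newton K) ∩ sumLe d b))
      atTop (nhds (volume.real (truncNewton K b))) := by
  set t : ℕ → ℝ := fun k => 1 + 1 / ((k : ℝ) + 1) with ht
  have ht0 : ∀ k, 0 < t k := fun k => by positivity
  have hanti : Antitone t := fun k l hkl => by
    simp only [ht]
    gcongr
  have hlim : Tendsto t atTop (nhds 1) := by
    simpa [ht] using (tendsto_one_div_add_atTop_nhds_zero_nat (𝕜 := ℝ)).const_add 1
  have hmono : Monotone fun k => (t k • newton K) ∩ sumLe d b := fun k l hkl =>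
    Set.inter_subset_inter_left _ (smul_newton_subset K (ht0 l) (hanti hkl))
  have hsub : ⋃ k, (t k • newton K) ∩ sumLe d b ⊆ truncNewton K b := by
    refine Set.iUnion_subset fun k => Set.inter_subset_inter_left _ ?_
    simpa using smul_newton_subset K one_pos (show 1 ≤ t k by simp only [ht]; simp; positivity)
  have hsup : interior (truncNewton K b) ⊆ ⋃ k, (t k • newton K) ∩ sumLe d b := by
    intro x hx
    have h1 : Tendsto (fun k => (t k)⁻¹ • x) atTop (nhds x) := by
      simpa using (hlim.inv₀ one_ne_zero).smul_const x
    obtain ⟨k, hk⟩ := (h1.eventually (mem_interior_iff_mem_nhds.1 hx)).exists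
    exact Set.mem_iUnion.2 ⟨k, (Set.mem_smul_set_iff_inv_smul_mem₀ (ht0 k).ne' _ _).2 hk.1,
      (interior_subset hx).2⟩
  have hvol : volume (⋃ k, (t k • newton K) ∩ sumLe d b) = volume (truncNewton K b) :=
    le_antisymm (measure_mono hsub) ((convex_truncNewton K b).volume_interior ▸ measure_mono hsup)
  have h2 := tendsto_measure_iUnion_atTop (μ := volume) hmono
  rw [hvol] at h2
  exact (ENNReal.tendsto_toReal (isBounded_truncNewton K b).measure_lt_top.ne).comp h2

/-- Asymptotic count of the monomials of bounded degree in the powers of a monomial ideal. -/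
lemma IsMonomialIdeal.tendsto_ncard_pow {K : Ideal (MvPolynomial (Fin d) 𝕜)}
    (hK : IsMonomialIdeal K) (b : ℕ) :
    Tendsto (fun m : ℕ =>
        ({u : Fin d →₀ ℕ | u ∈ exps (K ^ m) ∧ ∑ j, u j ≤ m * b}.ncard : ℝ) / (m : ℝ) ^ d)
      atTop (nhds (volume.real (truncNewton K b))) := by
  have hfin : ∀ m, {u : Fin d →₀ ℕ | u ∈ exps (K ^ m) ∧ ∑ j, u j ≤ m * b}.Finite := fun m =>
    (finite_setOf_sum_le (m * b)).subset fun u hu => hu.2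
  refine tendsto_order.2 ⟨fun a ha => ?_, fun a ha => ?_⟩
  · obtain ⟨k, hk⟩ := ((tendsto_volume_smul_newton K b).eventually (lt_mem_nhds ha)).exists
    set t : ℝ := 1 + 1 / ((k : ℝ) + 1) with ht
    have ht0 : 0 < t := by positivity
    have ht1 : 0 < t - 1 := by simp only [ht, add_sub_cancel_left]; positivity
    have h0 : ∀ x ∈ (t • newton K) ∩ sumLe d b, 0 ≤ x := by
      rintro _ ⟨⟨x, hx, rfl⟩, -⟩
      exact smul_nonneg ht0.le (newton_nonneg hx)
    have hlim := (((convex_newton K).smul t).inter (convex_sumLe b)).tendsto_ncard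
      (isBounded_of_sumLe h0 Set.inter_subset_right) h0
    filter_upwards [hlim.eventually (lt_mem_nhds hk), eventually_gt_atTop 0,
      eventually_ge_atTop ⌈((d : ℝ) + 1) / (t - 1)⌉₊] with m hm hm0 hmt
    have hm' : (0 : ℝ) < m := by exact_mod_cast hm0
    refine hm.trans_le ?_
    refine div_le_div_of_nonneg_right (Nat.cast_le.2 (Set.ncard_le_ncard ?_ (hfin m)))
      (by positivity)
    · rintro u ⟨hu1, hu2⟩
      refine ⟨mem_exps_pow_of_toR_mem (t := m * t) ?_ ?_, (inv_smul_toR_mem_sumLe hm0).1 hu2⟩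
      · have := (div_le_iff₀ ht1).1 ((Nat.le_ceil _).trans (Nat.cast_le.2 hmt))
        linarith
      · rw [mul_smul, Set.mem_smul_set_iff_inv_smul_mem₀ hm'.ne']
        exact hu1
  · have hlim := (convex_truncNewton K b).tendsto_ncard (isBounded_truncNewton K b)
      fun x hx => newton_nonneg hx.1
    filter_upwards [hlim.eventually (gt_mem_nhds ha), eventually_gt_atTop 0] with m hm hm0
    have hm' : (0 : ℝ) < m := by exact_mod_cast hm0
    refine lt_of_le_of_lt ?_ hm
    refine div_le_div_of_nonneg_right (Nat.cast_le.2 (Set.ncard_le_ncard ?_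
      (finite_setOf_smul_toR_mem (isBounded_truncNewton K b) hm0))) (by positivity)
    · rintro u ⟨hu1, hu2⟩
      refine ⟨?_, (inv_smul_toR_mem_sumLe hm0).2 hu2⟩
      obtain ⟨l, rfl⟩ := Nat.exists_eq_succ_of_ne_zero hm0.ne'
      exact (Set.mem_smul_set_iff_inv_smul_mem₀ hm'.ne' _ _).1 (hK.toR_mem_smul_newton l hu1)

end Limit

section Body

variable {d : ℕ}

/-- The rescaled points `u / m` of a graded set of lattice points. -/
def levelPoints (S : Set ((Fin d →₀ ℕ) × ℕ)) : Set (Fin d → ℝ) :=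
  {x | ∃ (u : Fin d →₀ ℕ) (m : ℕ), 0 < m ∧ (u, m) ∈ S ∧ x = (m : ℝ)⁻¹ • toR u}

lemma embedReal_fst (q : (Fin d →₀ ℕ) × ℕ) : (embedReal q).1 = toR q.1 := rfl

lemma embedReal_snd (q : (Fin d →₀ ℕ) × ℕ) : (embedReal q).2 = q.2 := rfl

lemma mem_fst_image_newtonBody {S : Set ((Fin d →₀ ℕ) × ℕ)} {x : Fin d → ℝ} :
    x ∈ Prod.fst '' newtonBody S ↔ (x, (1 : ℝ)) ∈ coneOf (embedReal '' S) := by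
  constructor
  · rintro ⟨⟨y, t⟩, ⟨hy, ht⟩, rfl⟩
    change t = 1 at ht
    subst ht
    exact hy
  · exact fun h => ⟨_, ⟨h, rfl⟩, rfl⟩

lemma levelPoints_subset (S : Set ((Fin d →₀ ℕ) × ℕ)) :
    levelPoints S ⊆ Prod.fst '' newtonBody S := by
  rintro _ ⟨u, m, hm, hu, rfl⟩
  rw [mem_fst_image_newtonBody]
  have hm' : (m : ℝ) ≠ 0 := by exact_mod_cast hm.ne'
  refine subset_closure ⟨1, fun _ => (m : ℝ)⁻¹, fun _ => embedReal (u, m), fun _ => by positivity,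
    fun _ => ⟨_, hu, rfl⟩, ?_⟩
  rw [Fin.sum_univ_one]
  ext1
  · rfl
  · simp [embedReal, hm']

/-- The Newton–Okounkov body is contained in the closed convex hull of the rescaled points, as
soon as degrees are linearly bounded. -/
lemma fst_image_newtonBody_subset {S : Set ((Fin d →₀ ℕ) × ℕ)} {b : ℕ}
    (hS : ∀ q ∈ S, ∑ j, q.1 j ≤ q.2 * b) :
    Prod.fst '' newtonBody S ⊆ closure (convexHull ℝ (levelPoints S)) := by
  intro x hx
  rw [mem_fst_image_newtonBody] at hx
  obtain ⟨y, hy, hlim⟩ := mem_closure_iff_seq_limit.1 hx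
  have h2 : Tendsto (fun k => (y k).2) atTop (nhds 1) := (continuous_snd.tendsto _).comp hlim
  have h1 : Tendsto (fun k => (y k).1) atTop (nhds x) := (continuous_fst.tendsto _).comp hlim
  have h3 : Tendsto (fun k => (y k).2⁻¹ • (y k).1) atTop (nhds x) := by
    simpa using (h2.inv₀ one_ne_zero).smul h1
  refine mem_closure_of_tendsto h3 ?_
  filter_upwards [h2.eventually (lt_mem_nhds one_pos)] with k hk
  obtain ⟨l, a, v, ha, hv, hyk⟩ := hy k
  choose q hq hqv using hv
  have hfst : (y k).1 = ∑ j, a j • toR (q j).1 := by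
    rw [hyk, Prod.fst_sum]
    exact Finset.sum_congr rfl fun j _ => by rw [Prod.smul_fst, ← hqv, embedReal_fst]
  have hsnd : (y k).2 = ∑ j, a j * (q j).2 := by
    rw [hyk, Prod.snd_sum]
    exact Finset.sum_congr rfl fun j _ => by rw [Prod.smul_snd, ← hqv, embedReal_snd, smul_eq_mul]
  have hzero : ∀ j, (q j).2 = 0 → toR (q j).1 = 0 := by
    intro j hj
    have := hS _ (hq j)
    rw [hj, zero_mul, Nat.le_zero, Finset.sum_eq_zero_iff] at this
    ext i
    simp [toR, this i (Finset.mem_univ i)]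
  have hcomb : (y k).2⁻¹ • (y k).1 = Finset.univ.centerMass (fun j => a j * (q j).2)
      fun j => ((q j).2 : ℝ)⁻¹ • toR (q j).1 := by
    rw [Finset.centerMass, ← hsnd, hfst]
    congr 1
    refine Finset.sum_congr rfl fun j _ => ?_
    rcases eq_or_ne (q j).2 0 with h | h
    · simp [hzero j h]
    · have h' : ((q j).2 : ℝ) ≠ 0 := by exact_mod_cast h
      rw [smul_smul, mul_assoc, mul_inv_cancel₀ h', mul_one]
  rw [hcomb, ← Finset.centerMass_filter_ne_zero]
  refine Finset.centerMass_mem_convexHull _ (fun j _ => by have := ha j; positivity) ?_ ?_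
  · rw [Finset.sum_filter_ne_zero, ← hsnd]
    exact hk
  · intro j hj
    have hne := (Finset.mem_filter.1 hj).2
    refine ⟨(q j).1, (q j).2, Nat.pos_of_ne_zero fun h => hne (by simp [h]), hq j, rfl⟩

lemma convex_fst_image_newtonBody (S : Set ((Fin d →₀ ℕ) × ℕ)) :
    Convex ℝ (Prod.fst '' newtonBody S) := by
  have h : Convex ℝ (coneOf (embedReal '' S)) := by
    refine Convex.closure ?_
    rintro _ ⟨k, a, v, ha, hv, rfl⟩ _ ⟨l, b, w, hb, hw, rfl⟩ s t hs ht -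
    refine ⟨k + l, Fin.append (s • a) (t • b), Fin.append v w, fun j => ?_, fun j => ?_, ?_⟩
    · refine Fin.addCases (fun i => ?_) (fun i => ?_) j
      · simpa using mul_nonneg hs (ha i)
      · simpa using mul_nonneg ht (hb i)
    · refine Fin.addCases (fun i => ?_) (fun i => ?_) j
      · simpa using hv i
      · simpa using hw i
    · simp [Fin.sum_univ_add, Finset.smul_sum, smul_smul]
  intro x hx y hy s t hs ht hst
  rw [mem_fst_image_newtonBody] at *
  simpa [hst] using h hx hy hs ht hst

lemma convexHull_levelPoints_subset_sumLe {S : Set ((Fin d →₀ ℕ) × ℕ)} {b : ℕ}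
    (hS : ∀ q ∈ S, ∑ j, q.1 j ≤ q.2 * b) :
    convexHull ℝ (levelPoints S) ⊆ sumLe d b :=
  convexHull_min (by
    rintro _ ⟨u, m, hm, hu, rfl⟩
    exact (inv_smul_toR_mem_sumLe hm).2 (hS _ hu)) (convex_sumLe _)

lemma convexHull_levelPoints_nonneg (S : Set ((Fin d →₀ ℕ) × ℕ)) {x : Fin d → ℝ}
    (hx : x ∈ convexHull ℝ (levelPoints S)) : 0 ≤ x :=
  convexHull_min (t := Set.Ici (0 : Fin d → ℝ)) (by
    rintro _ ⟨u, m, hm, hu, rfl⟩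
    exact smul_nonneg (by positivity) (toR_nonneg u)) (convex_Ici _) hx

lemma fst_image_newtonBody_nonneg {S : Set ((Fin d →₀ ℕ) × ℕ)} {b : ℕ}
    (hS : ∀ q ∈ S, ∑ j, q.1 j ≤ q.2 * b) {x : Fin d → ℝ} (hx : x ∈ Prod.fst '' newtonBody S) :
    0 ≤ x :=
  closure_minimal (fun _ hy => convexHull_levelPoints_nonneg S hy) isClosed_Ici
    (fst_image_newtonBody_subset hS hx)

lemma isBounded_convexHull_levelPoints {S : Set ((Fin d →₀ ℕ) × ℕ)} {b : ℕ}
    (hS : ∀ q ∈ S, ∑ j, q.1 j ≤ q.2 * b) :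
    Bornology.IsBounded (convexHull ℝ (levelPoints S)) :=
  isBounded_of_sumLe (fun _ hx => convexHull_levelPoints_nonneg S hx)
    (convexHull_levelPoints_subset_sumLe hS)

lemma volDelta_le {S : Set ((Fin d →₀ ℕ) × ℕ)} {b : ℕ} (hS : ∀ q ∈ S, ∑ j, q.1 j ≤ q.2 * b) :
    volDelta S ≤ volume.real (interior (convexHull ℝ (levelPoints S))) := by
  have hc : Convex ℝ (convexHull ℝ (levelPoints S)) := convex_convexHull _ _
  rw [measureReal_def, hc.volume_interior, ← measureReal_def, ← hc.volume_real_closure]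
  exact measureReal_mono (fst_image_newtonBody_subset hS)
    (isBounded_convexHull_levelPoints hS).closure.measure_lt_top.ne

end Body

section Families

variable {𝕜 : Type*} [Field 𝕜] {d : ℕ} {ι : Type*} [Fintype ι]

lemma IsGradedFamily.pow_le {R : Type*} [CommSemiring R] {I : ℕ → Ideal R}
    (hI : IsGradedFamily I) (n k : ℕ) : I n ^ k ≤ I (n * k) := by
  induction k with
  | zero => rw [mul_zero, hI.1]; exact le_top
  | succ k ih =>
    rw [pow_succ, mul_add, mul_one]
    exact (Ideal.mul_mono_left ih).trans (hI.2 _ _)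

lemma prod_pow_pow_le {R : Type*} [CommSemiring R] {L : ι → ℕ → Ideal R}
    (hL : ∀ i, IsGradedFamily (L i)) (a : ι → ℕ) (p m : ℕ) :
    (∏ i, L i p ^ a i) ^ m ≤ ∏ i, L i (m * p * a i) := by
  rw [← Finset.prod_pow]
  refine Finset.prod_le_prod' fun i _ => ?_
  rw [← pow_mul]
  refine ((hL i).pow_le p _).trans_eq ?_
  congr 1
  ring

lemma exists_mul_le_prod_pow {R : Type*} [CommSemiring R] {L : ι → ℕ → Ideal R}
    (hL : ∀ i, IsGradedFamily (L i)) (a : ι → ℕ) (M : ℕ) :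
    ∃ P : ℕ, 0 < P ∧ ∀ q s : ℕ,
      (∏ i, L i (M * a i)) ^ (q * P) * ∏ i, L i s ^ a i ≤ ∏ i, L i (M * P * q + s) ^ a i := by
  classical
  refine ⟨∏ i, if a i = 0 then 1 else a i, Finset.prod_pos fun i _ => ?_, fun q s => ?_⟩
  · split_ifs with h
    · exact one_pos
    · exact Nat.pos_of_ne_zero h
  rw [← Finset.prod_pow, ← Finset.prod_mul_distrib]
  refine Finset.prod_le_prod' fun i _ => ?_
  by_cases h : a i = 0
  · rw [h, pow_zero (L i (_ + s)), Ideal.one_eq_top]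
    exact le_top
  · obtain ⟨P', hP'⟩ : a i ∣ ∏ i, if a i = 0 then 1 else a i := by
      have := Finset.dvd_prod_of_mem (fun i => if a i = 0 then 1 else a i) (Finset.mem_univ i)
      simpa [h] using this
    rw [hP', show q * (a i * P') = (P' * q) * a i by ring, pow_mul, ← mul_pow]
    refine Ideal.pow_right_mono ?_ _
    refine (Ideal.mul_mono_left ((hL i).pow_le _ _)).trans (((hL i).2 _ _).trans_eq ?_)
    congr 1
    ring

lemma exists_mem_exps_forall_lt {L : ι → ℕ → Ideal (MvPolynomial (Fin d) 𝕜)}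
    (hmon : ∀ i n, IsMonomialIdeal (L i n)) (hne : ∀ i n, L i n ≠ ⊥) (a : ι → ℕ) (N : ℕ) :
    ∃ w : Fin d →₀ ℕ, ∀ s < N, w ∈ exps (∏ i, L i s ^ a i) := by
  have h : ∀ s, (exps (∏ i, L i s ^ a i)).Nonempty := fun s => by
    refine (IsMonomialIdeal.prod _ fun i => (hmon i s).pow _).exps_nonempty ?_
    exact Finset.prod_ne_zero_iff.2 fun i _ => pow_ne_zero _ (hne i s)
  choose w hw using h
  refine ⟨∑ s ∈ Finset.range N, w s, fun s hs => ?_⟩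
  rw [← Finset.add_sum_erase _ _ (Finset.mem_range.2 hs)]
  exact add_mem_exps (hw s) _

lemma eventually_smul_mem_newton {L : ι → ℕ → Ideal (MvPolynomial (Fin d) 𝕜)}
    (hL : ∀ i, IsGradedFamily (L i)) (hmon : ∀ i n, IsMonomialIdeal (L i n))
    (hne : ∀ i n, L i n ≠ ⊥) (a : ι → ℕ) {S : Set ((Fin d →₀ ℕ) × ℕ)}
    (hS : ∀ q ∈ S, q.1 ∈ exps (∏ i, L i (q.2 * a i))) {x : Fin d → ℝ}
    (hx : x ∈ convexHull ℝ (levelPoints S)) {δ : ℝ} (hδ : 0 < δ) :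
    ∀ᶠ p : ℕ in atTop, (p : ℝ) • (x + fun _ => δ) ∈ newton (∏ i, L i p ^ a i) := by
  refine convexHull_min
    (t := {x | ∀ᶠ p : ℕ in atTop, (p : ℝ) • (x + fun _ => δ) ∈ newton (∏ i, L i p ^ a i)})
    ?_ ?_ hx
  · rintro _ ⟨u, M, hM, hu, rfl⟩
    obtain ⟨P, hP, hle⟩ := exists_mul_le_prod_pow hL a M
    obtain ⟨w, hw⟩ := exists_mem_exps_forall_lt hmon hne a (M * P)
    filter_upwards [eventually_ge_atTop ⌈(∑ j, (w j : ℝ)) / δ⌉₊] with p hp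
    have hmem : (p / (M * P) * P) • u + w ∈ exps (∏ i, L i p ^ a i) := by
      have h1 := add_mem_exps_mul (nsmul_mem_exps_pow (hS _ hu) (p / (M * P) * P))
        (hw (p % (M * P)) (Nat.mod_lt _ (Nat.mul_pos hM hP)))
      have h2 := exps_mono (hle (p / (M * P)) (p % (M * P))) h1
      rwa [Nat.div_add_mod] at h2
    refine mem_newton_of_le (toR_mem_newton hmem) fun j => ?_
    have hM' : (0 : ℝ) < M := by exact_mod_cast hM
    have h1 : ((p / (M * P) * P : ℕ) : ℝ) ≤ p * (M : ℝ)⁻¹ := by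
      rw [le_mul_inv_iff₀ hM']
      exact_mod_cast (show p / (M * P) * P * M = p / (M * P) * (M * P) by ring).trans_le
        (Nat.div_mul_le_self _ _)
    have h2 : (w j : ℝ) ≤ p * δ :=
      (Finset.single_le_sum (f := fun j => (w j : ℝ)) (fun _ _ => Nat.cast_nonneg _)
        (Finset.mem_univ j)).trans ((div_le_iff₀ hδ).1 ((Nat.le_ceil _).trans (Nat.cast_le.2 hp)))
    have h3 : (0 : ℝ) ≤ u j := Nat.cast_nonneg _
    have h4 := mul_le_mul_of_nonneg_right h1 h3
    simp only [toR_apply, Finsupp.add_apply, Finsupp.smul_apply, smul_eq_mul, Pi.smul_apply,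
      Pi.add_apply, Nat.cast_add, Nat.cast_mul] at h4 ⊢
    linarith
  · intro x hx y hy s t hs ht hst
    filter_upwards [hx, hy] with p hpx hpy
    have := convex_newton _ hpx hpy hs ht hst
    convert this using 1
    ext j
    simp only [Pi.smul_apply, Pi.add_apply, smul_eq_mul]
    linear_combination (-(p : ℝ) * δ) * hst

lemma volume_real_smul_preimage {p : ℕ} (hp : 0 < p) (s : Set (Fin d → ℝ)) :
    volume.real ((fun x => (p : ℝ) • x) ⁻¹' s) = volume.real s / (p : ℝ) ^ d := by
  have hp' : (p : ℝ) ≠ 0 := by exact_mod_cast hp.ne'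
  rw [measureReal_def, Measure.addHaar_preimage_smul _ hp', ENNReal.toReal_mul,
    ENNReal.toReal_ofReal (abs_nonneg _), Module.finrank_fin_fun, abs_of_nonneg (by positivity),
    ← measureReal_def, div_eq_inv_mul]

/-- The truncated Newton polyhedra of the `p`-th members, rescaled by `p`, asymptotically fill the
convex hull of the rescaled points. -/
lemma eventually_volume_le {L : ι → ℕ → Ideal (MvPolynomial (Fin d) 𝕜)}
    (hL : ∀ i, IsGradedFamily (L i)) (hmon : ∀ i n, IsMonomialIdeal (L i n))
    (hne : ∀ i n, L i n ≠ ⊥) (a : ι → ℕ) (b : ℕ) {S : Set ((Fin d →₀ ℕ) × ℕ)}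
    (hS : ∀ q ∈ S, q.1 ∈ exps (∏ i, L i (q.2 * a i)))
    (hSb : ∀ q ∈ S, ∑ j, q.1 j ≤ q.2 * b) {ε : ℝ} (hε : 0 < ε) :
    ∀ᶠ p : ℕ in atTop, volume.real (interior (convexHull ℝ (levelPoints S))) - ε ≤
      volume.real (truncNewton (∏ i, L i p ^ a i) ((p * b : ℕ) : ℝ)) / (p : ℝ) ^ d := by
  set U := interior (convexHull ℝ (levelPoints S)) with hU
  set C : ℕ → Set (Fin d → ℝ) := fun p =>
    (fun x => (p : ℝ) • x) ⁻¹' truncNewton (∏ i, L i p ^ a i) ((p * b : ℕ) : ℝ) with hC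
  have hmem : ∀ x ∈ U, ∀ᶠ p : ℕ in atTop, x ∈ C p := by
    intro x hx
    have hlim : Tendsto (fun n : ℕ => x - fun _ => 1 / ((n : ℝ) + 1)) atTop (nhds x) := by
      refine tendsto_pi_nhds.2 fun j => ?_
      simpa using (tendsto_one_div_add_atTop_nhds_zero_nat (𝕜 := ℝ)).const_sub (x j)
    obtain ⟨n, hn⟩ := (hlim.eventually (mem_interior_iff_mem_nhds.1 hx)).exists
    have h := eventually_smul_mem_newton hL hmon hne a hS hn
      (show (0 : ℝ) < 1 / ((n : ℝ) + 1) by positivity)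
    filter_upwards [h] with p hp
    refine ⟨by simpa using hp, ?_⟩
    have h2 : ∑ j, x j ≤ b := convexHull_levelPoints_subset_sumLe hSb (interior_subset hx)
    change ∑ j, (p : ℝ) * x j ≤ ((p * b : ℕ) : ℝ)
    rw [← Finset.mul_sum, Nat.cast_mul]
    gcongr
  set V : ℕ → Set (Fin d → ℝ) := fun q => {x | x ∈ U ∧ ∀ p ≥ q, x ∈ C p} with hV
  have hmono : Monotone V := fun q q' hqq' x hx => ⟨hx.1, fun p hp => hx.2 p (hqq'.trans hp)⟩
  have hunion : ⋃ q, V q = U := by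
    refine Set.Subset.antisymm (Set.iUnion_subset fun q x hx => hx.1) fun x hx => ?_
    obtain ⟨q, hq⟩ := eventually_atTop.1 (hmem x hx)
    exact Set.mem_iUnion.2 ⟨q, hx, hq⟩
  have hUfin : volume U ≠ ⊤ :=
    ((isBounded_convexHull_levelPoints hSb).subset interior_subset).measure_lt_top.ne
  have hlim := tendsto_measure_iUnion_atTop (μ := volume) hmono
  rw [hunion] at hlim
  have hlim' : Tendsto (fun q => volume.real (V q)) atTop (nhds (volume.real U)) :=
    (ENNReal.tendsto_toReal hUfin).comp hlim
  filter_upwards [hlim'.eventually (lt_mem_nhds (sub_lt_self _ hε)), eventually_gt_atTop 0]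
    with p hp hp0
  rw [← volume_real_smul_preimage hp0]
  refine hp.le.trans (measureReal_mono (fun x hx => hx.2 p le_rfl) ?_)
  have hp' : (p : ℝ) ≠ 0 := by exact_mod_cast hp0.ne'
  rw [Measure.addHaar_preimage_smul _ hp']
  exact ENNReal.mul_ne_top ENNReal.ofReal_ne_top (isBounded_truncNewton _ _).measure_lt_top.ne

/-- Approximation of the volume of the Newton–Okounkov body attached to finitely many graded
families of nonzero monomial ideals by the multiplicities attached to their `p`-th members. -/
theorem exists_forall_tendsto_quotDim {L : ι → ℕ → Ideal (MvPolynomial (Fin d) 𝕜)}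
    (hL : ∀ i, IsGradedFamily (L i)) (hmon : ∀ i n, IsMonomialIdeal (L i n))
    (hne : ∀ i n, L i n ≠ ⊥) (a : ι → ℕ) (b : ℕ) {S : Set ((Fin d →₀ ℕ) × ℕ)}
    (hS : ∀ q, q ∈ S ↔ q.1 ∈ exps (∏ i, L i (q.2 * a i)) ∧ ∑ j, q.1 j ≤ q.2 * b)
    {ε : ℝ} (hε : 0 < ε) :
    ∃ p0 : ℕ, ∀ p : ℕ, p0 ≤ p → ∃ H : ℝ,
      Tendsto (fun m : ℕ => (quotDim 𝕜 ((∏ i, L i p ^ a i) ^ m)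
          (mId 𝕜 d ^ (m * (p * b) + 1) ⊓ (∏ i, L i p ^ a i) ^ m) : ℝ) /
            ((m : ℝ) ^ d * (p : ℝ) ^ d)) atTop (nhds H) ∧
        H ≤ volDelta S ∧ volDelta S - ε ≤ H := by
  have hSb : ∀ q ∈ S, ∑ j, q.1 j ≤ q.2 * b := fun q hq => ((hS q).1 hq).2
  obtain ⟨p0, hp0⟩ := eventually_atTop.1 ((eventually_volume_le hL hmon hne a b
    (fun q hq => ((hS q).1 hq).1) hSb hε).and (eventually_gt_atTop 0))
  refine ⟨p0, fun p hp => ?_⟩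
  obtain ⟨hvol, hp1⟩ := hp0 p hp
  have hK : IsMonomialIdeal (∏ i, L i p ^ a i) := IsMonomialIdeal.prod _ fun i => (hmon i p).pow _
  have hlim := (hK.tendsto_ncard_pow (p * b)).div_const ((p : ℝ) ^ d)
  refine ⟨_, hlim.congr fun m => ?_, ?_, ?_⟩
  · rw [quotDim_eq_ncard (hK.pow m), div_div]
  · have hb : Bornology.IsBounded (Prod.fst '' newtonBody S) :=
      (isBounded_convexHull_levelPoints hSb).closure.subset (fst_image_newtonBody_subset hSb)
    have hlim2 := ((convex_fst_image_newtonBody S).tendsto_ncard hb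
      fun x hx => fst_image_newtonBody_nonneg hSb hx).comp
        (tendsto_id.atTop_mul_const' hp1)
    refine le_of_tendsto_of_tendsto hlim hlim2 ?_
    filter_upwards [eventually_gt_atTop 0] with m hm
    simp only [Function.comp_apply, id_eq, div_div, Nat.cast_mul, mul_pow]
    refine div_le_div_of_nonneg_right (Nat.cast_le.2 (Set.ncard_le_ncard ?_ ?_)) (by positivity)
    · rintro u ⟨hu1, hu2⟩
      refine levelPoints_subset S ⟨u, m * p, Nat.mul_pos hm hp1, (hS _).2 ⟨?_, ?_⟩, by simp⟩
      · exact exps_mono (prod_pow_pow_le hL a p m) hu1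
      · exact hu2.trans_eq (mul_assoc _ _ _).symm
    · simpa using finite_setOf_smul_toR_mem hb (Nat.mul_pos hm hp1)
  · exact (sub_le_sub_right (volDelta_le hSb) ε).trans hvol

end Families

lemma IsMPrimary.ne_bot {𝕜 : Type*} [Field 𝕜] {d : ℕ} (hd : 0 < d)
    {I : Ideal (MvPolynomial (Fin d) 𝕜)} (hI : IsMPrimary I) : I ≠ ⊥ := by
  obtain ⟨-, k, hk⟩ := hI
  rintro rfl
  have hX : (MvPolynomial.X ⟨0, hd⟩ : MvPolynomial (Fin d) 𝕜) ^ k ∈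
      (⊥ : Ideal (MvPolynomial (Fin d) 𝕜)) :=
    hk (Ideal.pow_mem_pow (Ideal.subset_span (Set.mem_range_self _)) k)
  exact pow_ne_zero k (MvPolynomial.X_ne_zero _) hX

/-- **Approximation in the Noetherian case.**
If the families `𝕀, 𝕁(1), …, 𝕁(r)` are Noetherian then, for fixed `n₀, 𝐧, ε > 0`,
there is `p₀` such that for all `p ≥ p₀` the limits
`H_p(n₀,𝐧) = lim_m dim_𝕜(𝐉(p)^{m𝐧}/(𝔪^{cmp(n₀+|𝐧|)+1} ∩ 𝐉(p)^{m𝐧}))/(m^d p^d)` and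
`Ĥ_p(n₀,𝐧) = lim_m dim_𝕜(I_p^{mn₀}𝐉(p)^{m𝐧}/(𝔪^{cmp(n₀+|𝐧|)+1} ∩ I_p^{mn₀}𝐉(p)^{m𝐧}))/(m^d p^d)`
exist and satisfy `Vol_d(Δ(Γ_{n₀,𝐧})) ≥ H_p ≥ Vol_d(Δ(Γ_{n₀,𝐧})) − ε` and
`Vol_d(Δ(Γ̂_{n₀,𝐧})) ≥ Ĥ_p ≥ Vol_d(Δ(Γ̂_{n₀,𝐧})) − ε`. -/
theorem statement12 {𝕜 : Type*} [Field 𝕜] (d r : ℕ) (hd : 0 < d)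
    (I : ℕ → Ideal (MvPolynomial (Fin d) 𝕜))
    (J : Fin r → ℕ → Ideal (MvPolynomial (Fin d) 𝕜)) (β c : ℕ)
    (hI : IsGradedFamily I)
    (hImon : ∀ n, IsMonomialIdeal (I n))
    (hIprim : ∀ n, 0 < n → IsMPrimary (I n))
    (hJ : ∀ i, IsGradedFamily (J i))
    (hJb : ∀ i n, IsMonomialBounded (J i n) (β * n))
    (hc : β < c)
    (hcap : ∀ (n0 : ℕ) (n : Fin r → ℕ),
      mId 𝕜 d ^ (c * (n0 + ∑ i, n i)) ⊓ (∏ i, J i (n i)) =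
        mId 𝕜 d ^ (c * (n0 + ∑ i, n i)) ⊓ (I n0 * ∏ i, J i (n i)))
    (hInoeth : FamilyNoetherian I) (hJnoeth : ∀ i, FamilyNoetherian (J i))
    (n0 : ℕ) (n : Fin r → ℕ) (ε : ℝ) (hε : 0 < ε) :
    ∃ p0 : ℕ, ∀ p : ℕ, p0 ≤ p →
      ∃ H Hhat : ℝ,
        Tendsto
          (fun m : ℕ =>
            (quotDim 𝕜 (∏ i, J i p ^ (m * n i))
                (mId 𝕜 d ^ (c * m * p * (n0 + ∑ i, n i) + 1) ⊓ ∏ i, J i p ^ (m * n i)) : ℝ) /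
              ((m : ℝ) ^ d * (p : ℝ) ^ d))
          atTop (nhds H) ∧
        Tendsto
          (fun m : ℕ =>
            (quotDim 𝕜 (I p ^ (m * n0) * ∏ i, J i p ^ (m * n i))
                (mId 𝕜 d ^ (c * m * p * (n0 + ∑ i, n i) + 1) ⊓
                  (I p ^ (m * n0) * ∏ i, J i p ^ (m * n i))) : ℝ) /
              ((m : ℝ) ^ d * (p : ℝ) ^ d))
          atTop (nhds Hhat) ∧
        volDelta (GammaSet 𝕜 J c n0 n) ≥ H ∧
        H ≥ volDelta (GammaSet 𝕜 J c n0 n) - ε ∧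
        volDelta (GammaHatSet 𝕜 I J c n0 n) ≥ Hhat ∧
        Hhat ≥ volDelta (GammaHatSet 𝕜 I J c n0 n) - ε := by
  have hJmon : ∀ i n, IsMonomialIdeal (J i n) := fun i n => by
    obtain ⟨-, S, -, hS⟩ := hJb i n
    exact ⟨S, hS⟩
  have hJne : ∀ i n, J i n ≠ ⊥ := fun i n => (hJb i n).1
  have hIne : ∀ n, I n ≠ ⊥ := fun n => by
    rcases Nat.eq_zero_or_pos n with rfl | hn
    · rw [hI.1]; exact top_ne_bot
    · exact (hIprim n hn).ne_bot hd
  obtain ⟨p1, h1⟩ := exists_forall_tendsto_quotDim hJ hJmon hJne n (c * (n0 + ∑ i, n i))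
    (S := GammaSet 𝕜 J c n0 n) (fun q => by
      rw [GammaSet, Set.mem_ofPred_eq, mem_exps, mul_left_comm, mul_assoc]) hε
  obtain ⟨p2, h2⟩ := exists_forall_tendsto_quotDim
    (L := fun o : Option (Fin r) => o.elim I J)
    (by rintro (_ | i); exacts [hI, hJ i])
    (by rintro (_ | i); exacts [hImon, hJmon i])
    (by rintro (_ | i); exacts [hIne, hJne i])
    (fun o => o.elim n0 n) (c * (n0 + ∑ i, n i))
    (S := GammaHatSet 𝕜 I J c n0 n) (fun q => by
      rw [GammaHatSet, Set.mem_ofPred_eq, mem_exps, Fintype.prod_option, mul_left_comm q.2 c,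
        mul_assoc c]
      rfl) hε
  refine ⟨max p1 p2, fun p hp => ?_⟩
  obtain ⟨H, hH, hH1, hH2⟩ := h1 p (le_of_max_le_left hp)
  obtain ⟨G, hG, hG1, hG2⟩ := h2 p (le_of_max_le_right hp)
  have hdeg : ∀ m : ℕ, m * (p * (c * (n0 + ∑ i, n i))) = c * m * p * (n0 + ∑ i, n i) :=
    fun m => by ring
  refine ⟨H, G, hH.congr fun m => ?_, hG.congr fun m => ?_, hH1, hH2, hG1, hG2⟩
  · simp only [← Finset.prod_pow, ← pow_mul, hdeg, mul_comm (n _) m]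
  · simp only [Fintype.prod_option, mul_pow, ← Finset.prod_pow, ← pow_mul, hdeg, Option.elim,
      mul_comm n0 m, mul_comm (n _) m]
end
end

section
/- For each p ≥ 1 let G_p be the homogeneous polynomial of total degree d+1 with G_p(n_0,𝐧) = lim_{m→∞} dim_𝕜( J(1)_p^{m n_1}⋯J(r)_p^{m n_r} / 𝔪^{m n_0} J(1)_p^{m n_1}⋯J(r)_p^{m n_r} ) / m^{d+1} for all (n_0,𝐧) ∈ ℕ^{r+1}. Then for all real λ_0, λ_1, …, λ_r ≥ 0, lim_{p→∞} G_p(λ_0, λ_1/p, …, λ_r/p) = ∫_0^{λ_0} Vol_d( tK_0 + λ_1K_1 + ⋯ + λ_rK_r ) dt; equivalently, writing G_p(n_0,𝐧) = Σ_{d_0+|𝐝|=d} e_{(d_0,𝐝)}(𝔪 | J(1)_p,…,J(r)_p)·n_0^{d_0+1}𝐧^𝐝/((d_0+1)!·𝐝!), for every (d_0,𝐝) ∈ ℕ^{r+1} with d_0+|𝐝| = d the normalized mixed multiplicities e_{(d_0,𝐝)}(𝔪 | J(1)_p,…,J(r)_p)/p^{|𝐝|} converge as p → ∞ to the mixed volume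 MV_d of the multiset consisting of d_0 copies of K_0 and d_i copies of K_i for 1 ≤ i ≤ r. -/
open Filter MvPolynomial Pointwise MeasureTheory

noncomputable section

/-- The projection `π₁ : ℝ^{d+1} → ℝ^d` to the first `d` coordinates. -/
def proj1 {d : ℕ} (y : Fin (d + 1) → ℝ) : Fin d → ℝ := fun i => y (Fin.castSucc i)

/-- A convex body: a compact convex set with nonempty interior. -/
def IsConvexBody {d : ℕ} (K : Set (Fin d → ℝ)) : Prop :=
  Convex ℝ K ∧ IsCompact K ∧ (interior K).Nonempty

/-- `h` is a suitable degree of homogenization of `K`: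
`h ≥ 1` and `K ⊆ π₁(π^{-1}(h) ∩ ℝ^{d+1}_{≥0})`, where `π(α) = α₁ + ⋯ + α_{d+1}`. -/
def SuitableDeg {d : ℕ} (K : Set (Fin d → ℝ)) (h : ℕ) : Prop :=
  0 < h ∧ K ⊆ proj1 '' ({y : Fin (d + 1) → ℝ | ∑ i, y i = (h : ℝ)} ∩ {y | ∀ i, 0 ≤ y i})

/-- The homogenization `K̃ = (K × ℝ) ∩ π^{-1}(h)` of a convex body `K ⊆ ℝ^d_{≥0}`. -/
def homogBody {d : ℕ} (K : Set (Fin d → ℝ)) (h : ℕ) : Set (Fin (d + 1) → ℝ) :=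
  {y | proj1 y ∈ K ∧ ∑ i, y i = (h : ℝ)}

/-- The cone `C_K = Cone(K̃)` over the homogenization of `K`. -/
def coneBody {d : ℕ} (K : Set (Fin d → ℝ)) (h : ℕ) : Set (Fin (d + 1) → ℝ) :=
  {x | ∃ t : ℝ, 0 ≤ t ∧ ∃ y ∈ homogBody K h, x = t • y}

/-- The semigroup `S_K = C_K ∩ ℕ^{d+1} ∩ ⋃_{k ≥ 1} π^{-1}(k h)`. -/
def SK {d : ℕ} (K : Set (Fin d → ℝ)) (h : ℕ) : Set (Fin (d + 1) →₀ ℕ) :=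
  {m | ((fun i => (m i : ℝ)) ∈ coneBody K h) ∧ ∃ k : ℕ, 1 ≤ k ∧ (∑ i, m i) = k * h}

/-- The graded family of monomial ideals associated to the convex body `K` with
homogenization degree `h`: `J_n` is generated by the monomials `x^𝐦` with
`𝐦 ∈ S_K` and `|𝐦| = n h`. -/
def JIdeal (𝕜 : Type*) [Field 𝕜] {d : ℕ} (K : Set (Fin d → ℝ)) (h : ℕ) (n : ℕ) :
    Ideal (MvPolynomial (Fin (d + 1)) 𝕜) :=
  Ideal.span ((fun m => MvPolynomial.monomial m (1 : 𝕜)) ''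
    {m ∈ SK K h | (∑ i, m i) = n * h})

/-- The standard simplex `K₀ = conv(0, 𝐞₁, …, 𝐞_d) ⊂ ℝ^d`. -/
def stdK0 (d : ℕ) : Set (Fin d → ℝ) :=
  convexHull ℝ (insert 0 (Set.range fun i : Fin d => (Pi.single i 1 : Fin d → ℝ)))

/-- The monomial ideal generated by the monomials with exponents in `S`. -/
def monomialIdeal (𝕜 : Type*) [Field 𝕜] {σ : Type*} (S : Set (σ →₀ ℕ)) :
    Ideal (MvPolynomial σ 𝕜) :=
  Ideal.span ((fun m => MvPolynomial.monomial m (1 : 𝕜)) '' S)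

section MonomialIdeal

variable {𝕜 : Type*} [Field 𝕜] {σ : Type*}

theorem monomialIdeal_add (S T : Set (σ →₀ ℕ)) :
    monomialIdeal 𝕜 (S + T) = monomialIdeal 𝕜 S * monomialIdeal 𝕜 T := by
  unfold monomialIdeal
  rw [Ideal.span_mul_span']
  congr 1
  refine Set.image_image2_distrib fun a b => ?_
  simp [MvPolynomial.monomial_mul]

theorem monomialIdeal_zero : monomialIdeal 𝕜 (0 : Set (σ →₀ ℕ)) = 1 := by
  unfold monomialIdeal
  rw [Ideal.one_eq_top, Ideal.eq_top_iff_one]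
  exact Ideal.subset_span ⟨0, rfl, rfl⟩

theorem monomialIdeal_sum {ι : Type*} (s : Finset ι) (S : ι → Set (σ →₀ ℕ)) :
    monomialIdeal 𝕜 (∑ i ∈ s, S i) = ∏ i ∈ s, monomialIdeal 𝕜 (S i) := by
  classical
  induction s using Finset.induction_on with
  | empty => simpa using monomialIdeal_zero
  | insert a s ha ih => rw [Finset.sum_insert ha, Finset.prod_insert ha, monomialIdeal_add, ih]

theorem prod_monomialIdeal_pow {ι : Type*} [Fintype ι] (S : ι → Set (σ →₀ ℕ)) (k : ι → ℕ) :
    ∏ i, monomialIdeal 𝕜 (S i) ^ k i =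
      monomialIdeal 𝕜 (∑ i, ∑ _j ∈ Finset.range (k i), S i) := by
  rw [monomialIdeal_sum]
  refine Finset.prod_congr rfl fun i _ => ?_
  rw [monomialIdeal_sum, Finset.prod_const, Finset.card_range]

theorem mem_monomialIdeal {S : Set (σ →₀ ℕ)} {f : MvPolynomial σ 𝕜} :
    f ∈ monomialIdeal 𝕜 S ↔ ∀ u ∈ f.support, ∃ s ∈ S, s ≤ u :=
  MvPolynomial.mem_ideal_span_monomial_image

theorem mId_pow (d c : ℕ) :
    mId 𝕜 d ^ c = monomialIdeal 𝕜 {u : Fin d →₀ ℕ | u.degree = c} :=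
  MvPolynomial.pow_idealOfVars_eq_span (σ := Fin d) (R := 𝕜) c

theorem exists_le_degree_eq (u : σ →₀ ℕ) (c : ℕ) (hc : c ≤ u.degree) :
    ∃ v ≤ u, v.degree = c := by
  classical
  induction c with
  | zero => exact ⟨0, zero_le, by simp⟩
  | succ c ih =>
    obtain ⟨v, hv, hvc⟩ := ih (by omega)
    have hne : v ≠ u := by rintro rfl; omega
    obtain ⟨i, hi⟩ : ∃ i, v i < u i := by
      by_contra! hcon
      exact hne (le_antisymm hv hcon)
    refine ⟨v + Finsupp.single i 1, fun j => ?_, by simp [hvc]⟩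
    by_cases hij : i = j
    · subst hij; simpa using hi
    · simpa [Finsupp.single_apply, hij] using hv j

theorem quotDim_eq_card [Fintype σ] (A B : Ideal (MvPolynomial σ 𝕜)) (F : Set (σ →₀ ℕ))
    (hF : F.Finite) (hmon : ∀ u ∈ F, MvPolynomial.monomial u (1 : 𝕜) ∈ A)
    (hAB : ∀ f ∈ A, f ∈ B ↔ ∀ u ∈ F, MvPolynomial.coeff u f = 0) :
    quotDim 𝕜 A B = Nat.card F := by
  classical
  have : Fintype F := hF.fintype
  let φ : ↥(Submodule.restrictScalars 𝕜 A) →ₗ[𝕜] (F → 𝕜) :=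
    LinearMap.pi (fun u => (MvPolynomial.lcoeff 𝕜 (u : σ →₀ ℕ)) ∘ₗ
      (Submodule.restrictScalars 𝕜 A).subtype)
  have hφ : ∀ f u, φ f u = MvPolynomial.coeff (u : σ →₀ ℕ) (f : MvPolynomial σ 𝕜) :=
    fun f u => rfl
  have hsurj : LinearMap.range φ = ⊤ := by
    rw [eq_top_iff, ← (Pi.basisFun 𝕜 F).span_eq, Submodule.span_le]
    rintro _ ⟨u, rfl⟩
    refine ⟨⟨MvPolynomial.monomial (u : σ →₀ ℕ) 1, hmon u u.2⟩, ?_⟩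
    ext v
    rw [hφ]
    simp [MvPolynomial.coeff_monomial, Pi.single_apply, Subtype.ext_iff, eq_comm]
  have hker : Submodule.comap (Submodule.restrictScalars 𝕜 A).subtype
      (Submodule.restrictScalars 𝕜 B) = LinearMap.ker φ := by
    ext f
    rw [Submodule.mem_comap, LinearMap.mem_ker, Submodule.restrictScalars_mem]
    refine (hAB f f.2).trans ⟨fun h => ?_, fun h u hu => ?_⟩
    · ext u; exact h u u.2
    · exact congrFun h ⟨u, hu⟩
  unfold quotDim
  rw [hker, (φ.quotKerEquivRange).finrank_eq, hsurj, finrank_top, Module.finrank_fintype_fun_eq_card,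
    Nat.card_eq_fintype_card]

theorem quotDim_monomialIdeal (d c D : ℕ) (S : Set (Fin d →₀ ℕ)) (hS : ∀ s ∈ S, s.degree = D) :
    quotDim 𝕜 (monomialIdeal 𝕜 S) (mId 𝕜 d ^ c * monomialIdeal 𝕜 S) =
      Nat.card {u : Fin d →₀ ℕ | (∃ s ∈ S, s ≤ u) ∧ u.degree < D + c} := by
  classical
  refine quotDim_eq_card _ _ _ ?_ ?_ ?_
  · refine (Finsupp.finite_of_degree_le (D + c)).subset ?_
    rintro u ⟨-, hu⟩
    exact hu.le
  · rintro u ⟨⟨s, hs, hsu⟩, -⟩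
    rw [mem_monomialIdeal]
    intro v hv
    have : v = u := by
      have := MvPolynomial.support_monomial_subset hv
      simpa using this
    exact ⟨s, hs, this ▸ hsu⟩
  · intro f hf
    rw [mId_pow, ← monomialIdeal_add, mem_monomialIdeal]
    rw [mem_monomialIdeal] at hf
    constructor
    · rintro h u ⟨-, hu⟩
      by_contra hne
      obtain ⟨_, ⟨a, ha, b, hb, rfl⟩, hle⟩ := h u (MvPolynomial.mem_support_iff.2 hne)
      have h1 := Finsupp.degree_mono hle
      simp only [Set.mem_ofPred_eq] at ha
      simp only [map_add, ha, hS b hb] at h1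
      omega
    · intro h u hu
      obtain ⟨s, hs, hsu⟩ := hf u hu
      have hdeg : D + c ≤ u.degree := by
        by_contra! hlt
        exact (MvPolynomial.mem_support_iff.1 hu) (h u ⟨⟨s, hs, hsu⟩, hlt⟩)
      obtain ⟨w, rfl⟩ := exists_add_of_le hsu
      have hw : c ≤ w.degree := by
        rw [map_add, hS s hs] at hdeg; omega
      obtain ⟨v, hv, hvc⟩ := exists_le_degree_eq w c hw
      exact ⟨v + s, ⟨v, hvc, s, hs, rfl⟩, by rw [add_comm s w]; gcongr⟩

end MonomialIdeal

section ExponentSets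

variable {d : ℕ}

/-- The exponents of the generators of `JIdeal 𝕜 K h p`. -/
def exponentSet (K : Set (Fin d → ℝ)) (h p : ℕ) : Set (Fin (d + 1) →₀ ℕ) :=
  {m ∈ SK K h | (∑ i, m i) = p * h}

/-- The real point of `ℝ^d` given by the first `d` entries of an exponent vector. -/
def realProj : (Fin (d + 1) →₀ ℕ) →+ (Fin d → ℝ) where
  toFun u := fun j => (u j.castSucc : ℝ)
  map_zero' := by ext; simp
  map_add' u v := by ext; simp

theorem realProj_apply (u : Fin (d + 1) →₀ ℕ) (j : Fin d) :
    realProj u j = (u j.castSucc : ℝ) := rfl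

theorem degree_eq_sum (u : Fin (d + 1) →₀ ℕ) : u.degree = ∑ i, u i :=
  Finsupp.degree_eq_sum u

theorem degree_eq_realProj (u : Fin (d + 1) →₀ ℕ) :
    (u.degree : ℝ) = ∑ j, realProj u j + u (Fin.last d) := by
  rw [degree_eq_sum, Fin.sum_univ_castSucc]
  push_cast
  rfl

theorem mem_exponentSet {K : Set (Fin d → ℝ)} {h p : ℕ} (hh : 0 < h) (hp : 0 < p)
    {u : Fin (d + 1) →₀ ℕ} :
    u ∈ exponentSet K h p ↔ realProj u ∈ (p : ℝ) • K ∧ u.degree = p * h := by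
  have hh' : (h : ℝ) ≠ 0 := by positivity
  have hp' : (p : ℝ) ≠ 0 := by positivity
  rw [degree_eq_sum]
  constructor
  · rintro ⟨⟨⟨t, ht, y, ⟨hyK, hyh⟩, hty⟩, -⟩, hu⟩
    refine ⟨?_, hu⟩
    have h1 : (p : ℝ) * h = t * h := by
      have : (p : ℝ) * h = ((∑ i, u i : ℕ) : ℝ) := by rw [hu]; push_cast; rfl
      rw [this, ← hyh, Finset.mul_sum]
      push_cast
      exact Finset.sum_congr rfl fun i _ => congrFun hty i
    have hpt : (p : ℝ) = t := mul_right_cancel₀ hh' h1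
    refine ⟨proj1 y, hyK, ?_⟩
    ext j
    have := congrFun hty j.castSucc
    simp only [Pi.smul_apply, smul_eq_mul] at this
    simp [realProj_apply, proj1, this, hpt]
  · rintro ⟨⟨y, hyK, hy⟩, hu⟩
    refine ⟨⟨⟨p, by positivity, (p : ℝ)⁻¹ • fun i => (u i : ℝ), ⟨?_, ?_⟩, ?_⟩, p, hp, hu⟩, hu⟩
    · convert hyK using 1
      ext j
      have := congrFun hy j
      simp only [Pi.smul_apply, smul_eq_mul, realProj_apply] at this
      simp [proj1, ← this, hp']
    · have : (((∑ i, u i : ℕ) : ℝ)) = p * h := by rw [hu]; push_cast; rfl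
      push_cast at this
      simp only [Pi.smul_apply, smul_eq_mul]
      rw [← Finset.mul_sum, this]
      field_simp
    · rw [smul_inv_smul₀ hp']

theorem exists_exponent (b : Fin d → ℤ) (t : ℕ) (hb : ∀ j, 0 ≤ b j) (hbt : ∑ j, b j ≤ t) :
    ∃ w : Fin (d + 1) →₀ ℕ, realProj w = (fun j => (b j : ℝ)) ∧ w.degree = t := by
  lift b to Fin d → ℕ using hb
  have hbt' : ∑ j, b j ≤ t := by
    rw [← Nat.cast_le (α := ℤ)]
    simpa using hbt
  refine ⟨Finsupp.equivFunOnFinite.symm (Fin.snoc (α := fun _ => ℕ) b (t - ∑ j, b j)), ?_, ?_⟩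
  · ext j
    simp [realProj_apply]
  · rw [degree_eq_sum, Fin.sum_univ_castSucc]
    simp only [Finsupp.equivFunOnFinite_symm_apply_apply, Fin.snoc_castSucc, Fin.snoc_last]
    omega

theorem exists_mem_exponentSet {K : Set (Fin d → ℝ)} {h p : ℕ} (hp : 0 < p)
    (hh : SuitableDeg K h) (b : Fin d → ℤ) (hb : (fun j => (b j : ℝ)) ∈ (p : ℝ) • K) :
    ∃ u ∈ exponentSet K h p, realProj u = fun j => (b j : ℝ) := by
  obtain ⟨hh0, hsub⟩ := hh
  obtain ⟨x, hx, hxb⟩ := hb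
  obtain ⟨y, ⟨hyh, hy0⟩, rfl⟩ := hsub hx
  have hbj : ∀ j, (b j : ℝ) = p * y j.castSucc := fun j => (congrFun hxb j).symm
  have hb0 : ∀ j, 0 ≤ b j := fun j => by
    have : (0 : ℝ) ≤ b j := by rw [hbj]; exact mul_nonneg (by positivity) (hy0 _)
    exact_mod_cast this
  have hbs : ∑ j, b j ≤ ((p * h : ℕ) : ℤ) := by
    have : ∑ j, (b j : ℝ) ≤ p * h := by
      simp_rw [hbj]
      rw [← Finset.mul_sum]
      gcongr
      rw [← hyh, Fin.sum_univ_castSucc]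
      linarith [hy0 (Fin.last d)]
    exact_mod_cast this
  obtain ⟨w, hw, hwd⟩ := exists_exponent b (p * h) hb0 hbs
  exact ⟨w, (mem_exponentSet hh0 hp).2 ⟨by rw [hw]; exact ⟨_, hx, hxb⟩, hwd⟩, hw⟩

theorem abs_floor_sub_floor_sub_le (v : ℝ) (l : ℕ) :
    |((⌊((l + 1 : ℕ) : ℝ) * v⌋ - ⌊(l : ℝ) * v⌋ : ℤ) : ℝ) - v| ≤ 1 := by
  have h1 := Int.floor_le (((l + 1 : ℕ) : ℝ) * v)
  have h2 := Int.lt_floor_add_one (((l + 1 : ℕ) : ℝ) * v)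
  have h3 := Int.floor_le ((l : ℝ) * v)
  have h4 := Int.lt_floor_add_one ((l : ℝ) * v)
  rw [Int.cast_sub]
  push_cast at h1 h2 ⊢
  rw [abs_le]
  constructor <;> linarith

theorem exists_mem_sum_exponentSet {K : Set (Fin d → ℝ)} {h p : ℕ} (hp : 0 < p)
    (hh : SuitableDeg K h) (q : Fin d → ℝ) (hq : Metric.closedBall q (p : ℝ)⁻¹ ⊆ K) (k : ℕ) :
    ∃ u ∈ ∑ _j ∈ Finset.range k, exponentSet K h p,
      realProj u = fun j => ((⌊(k : ℝ) * (p * q j)⌋ : ℤ) : ℝ) := by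
  have hp' : (p : ℝ) ≠ 0 := by positivity
  have key : ∀ l : ℕ, ∃ u ∈ exponentSet K h p, realProj u = fun j =>
      ((⌊((l + 1 : ℕ) : ℝ) * (p * q j)⌋ - ⌊(l : ℝ) * (p * q j)⌋ : ℤ) : ℝ) := by
    intro l
    refine exists_mem_exponentSet hp hh _ ?_
    rw [Set.mem_smul_set_iff_inv_smul_mem₀ hp']
    refine hq ?_
    rw [Metric.mem_closedBall, dist_pi_le_iff (by positivity)]
    intro j
    rw [Real.dist_eq, Pi.smul_apply, smul_eq_mul]
    have := abs_floor_sub_floor_sub_le (p * q j) l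
    rw [show (p : ℝ)⁻¹ * ((⌊((l + 1 : ℕ) : ℝ) * (p * q j)⌋ - ⌊(l : ℝ) * (p * q j)⌋ : ℤ) : ℝ) - q j
      = (p : ℝ)⁻¹ * (((⌊((l + 1 : ℕ) : ℝ) * (p * q j)⌋ - ⌊(l : ℝ) * (p * q j)⌋ : ℤ) : ℝ) - p * q j)
      by field_simp, abs_mul, abs_of_nonneg (by positivity)]
    exact mul_le_of_le_one_right (by positivity) this
  choose f hf hfp using key
  refine ⟨∑ l ∈ Finset.range k, f l, ?_, ?_⟩
  · rw [Set.mem_finsetSum]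
    exact ⟨f, fun _ => hf _, rfl⟩
  · rw [map_sum]
    ext j
    rw [Finset.sum_apply]
    simp_rw [hfp]
    rw [← Int.cast_sum, Finset.sum_range_sub (fun l : ℕ => ⌊(l : ℝ) * (p * q j)⌋)]
    simp

theorem degree_of_mem_sum {S : Set (Fin (d + 1) →₀ ℕ)} {D k : ℕ} (hS : ∀ u ∈ S, u.degree = D)
    {u : Fin (d + 1) →₀ ℕ} (hu : u ∈ ∑ _j ∈ Finset.range k, S) : u.degree = k * D := by
  rw [Set.mem_finsetSum] at hu
  obtain ⟨g, hg, rfl⟩ := hu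
  rw [map_sum, Finset.sum_congr rfl fun i hi => hS _ (hg hi)]
  simp

theorem realProj_of_mem_sum {K : Set (Fin d → ℝ)} (hK : Convex ℝ K) (hne : K.Nonempty)
    {S : Set (Fin (d + 1) →₀ ℕ)} {p : ℕ} (hS : ∀ u ∈ S, realProj u ∈ (p : ℝ) • K) (k : ℕ)
    {u : Fin (d + 1) →₀ ℕ} (hu : u ∈ ∑ _j ∈ Finset.range k, S) :
    realProj u ∈ ((k * p : ℕ) : ℝ) • K := by
  induction k generalizing u with
  | zero =>
    simp only [Finset.range_zero, Finset.sum_empty, Set.mem_zero] at hu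
    simp [hu, Set.zero_smul_set hne]
  | succ k ih =>
    rw [Finset.sum_range_succ] at hu
    obtain ⟨a, ha, b, hb, rfl⟩ := hu
    rw [Nat.succ_mul, Nat.cast_add, hK.add_smul (by positivity) (by positivity), map_add]
    exact Set.add_mem_add (ih ha) (hS b hb)

end ExponentSets

section Region

variable {d : ℕ}

theorem mem_stdK0 {x : Fin d → ℝ} : x ∈ stdK0 d ↔ (∀ j, 0 ≤ x j) ∧ ∑ j, x j ≤ 1 := by
  constructor
  · intro hx
    have hconv : Convex ℝ {x : Fin d → ℝ | (∀ j, 0 ≤ x j) ∧ ∑ j, x j ≤ 1} := by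
      rintro x ⟨hx, hx1⟩ y ⟨hy, hy1⟩ a b ha hb hab
      refine ⟨fun j => ?_, ?_⟩
      · have := hx j; have := hy j
        simp only [Pi.add_apply, Pi.smul_apply, smul_eq_mul]
        positivity
      · simp only [Pi.add_apply, Pi.smul_apply, smul_eq_mul, Finset.sum_add_distrib,
          ← Finset.mul_sum]
        nlinarith
    refine convexHull_min ?_ hconv hx
    rintro y (rfl | ⟨i, rfl⟩)
    · simp
    · refine ⟨fun j => ?_, by simp⟩
      by_cases h : j = i
      · subst h; simp
      · simp [h]
  · rintro ⟨hx, hx1⟩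
    have := (convex_convexHull ℝ (insert 0 (Set.range fun i : Fin d =>
      (Pi.single i 1 : Fin d → ℝ)))).sum_mem (t := (Finset.univ : Finset (Option (Fin d))))
      (w := fun o => o.elim (1 - ∑ j, x j) x)
      (z := fun o => o.elim 0 fun i => Pi.single i 1)
      (by rintro (_ | j) -
          · simpa using hx1
          · exact hx j)
      (by simp [Fintype.sum_option])
      (by rintro (_ | j) -
          · exact subset_convexHull _ _ (Set.mem_insert _ _)
          · exact subset_convexHull _ _ (Set.mem_insert_of_mem _ ⟨j, rfl⟩))
    rw [Fintype.sum_option] at this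
    unfold stdK0
    convert this using 1
    ext j
    simp [Finset.sum_apply, Pi.single_apply]

theorem mem_smul_stdK0 {x : Fin d → ℝ} {t : ℝ} (ht : 0 ≤ t) :
    x ∈ t • stdK0 d ↔ (∀ j, 0 ≤ x j) ∧ ∑ j, x j ≤ t := by
  rcases ht.eq_or_lt with rfl | ht
  · have hne : (stdK0 d).Nonempty := ⟨0, mem_stdK0.2 (by simp)⟩
    rw [Set.zero_smul_set hne, Set.mem_zero]
    constructor
    · rintro rfl; simp
    · rintro ⟨h0, h1⟩
      have := (Finset.sum_eq_zero_iff_of_nonneg (fun j _ => h0 j)).1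
        (le_antisymm h1 (Finset.sum_nonneg fun j _ => h0 j))
      ext j
      exact this j (Finset.mem_univ j)
  · rw [Set.mem_smul_set_iff_inv_smul_mem₀ ht.ne', mem_stdK0]
    simp only [Pi.smul_apply, smul_eq_mul, ← Finset.mul_sum]
    refine and_congr (forall_congr' fun j => ?_) ?_
    · rw [mul_nonneg_iff_of_pos_left (by positivity)]
    · rw [inv_mul_le_iff₀ ht, mul_one]

/-- The truncated cone over the standard simplex. -/
def simplexCone (d : ℕ) (a : ℝ) : Set (Fin (d + 1) → ℝ) :=
  {y | (∀ j : Fin d, 0 ≤ y j.succ) ∧ ∑ j : Fin d, y j.succ ≤ y 0 ∧ y 0 ≤ a}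

theorem convex_simplexCone (a : ℝ) : Convex ℝ (simplexCone d a) := by
  rintro x ⟨hx, hx1, hx2⟩ y ⟨hy, hy1, hy2⟩ s t hs ht hst
  refine ⟨fun j => ?_, ?_, ?_⟩
  · have := hx j; have := hy j
    simp only [Pi.add_apply, Pi.smul_apply, smul_eq_mul]
    positivity
  · simp only [Pi.add_apply, Pi.smul_apply, smul_eq_mul, Finset.sum_add_distrib,
      ← Finset.mul_sum]
    gcongr
  · simp only [Pi.add_apply, Pi.smul_apply, smul_eq_mul]
    calc s * x 0 + t * y 0 ≤ s * a + t * a := by gcongr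
      _ = a := by rw [← add_mul, hst, one_mul]

theorem isCompact_simplexCone (a : ℝ) : IsCompact (simplexCone d a) := by
  refine (isCompact_Icc (a := (0 : Fin (d + 1) → ℝ)) (b := fun _ => a)).of_isClosed_subset ?_ ?_
  · have : simplexCone d a = (⋂ j : Fin d, {y | 0 ≤ y j.succ}) ∩
        ({y | ∑ j : Fin d, y j.succ ≤ y 0} ∩ {y | y 0 ≤ a}) := by
      ext; simp [simplexCone]
    rw [this]
    exact (isClosed_iInter fun j => isClosed_le (by fun_prop) (by fun_prop)).inter
      ((isClosed_le (by fun_prop) (by fun_prop)).inter (isClosed_le (by fun_prop) (by fun_prop)))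
  · rintro y ⟨h0, h1, h2⟩
    have hle : ∀ j : Fin d, y j.succ ≤ y 0 := fun j =>
      (Finset.single_le_sum (f := fun j : Fin d => y j.succ)
        (fun j _ => h0 j) (Finset.mem_univ j)).trans h1
    have hnn : 0 ≤ y 0 := (Finset.sum_nonneg fun j _ => h0 j).trans h1
    rw [Set.mem_Icc, Pi.le_def, Pi.le_def]
    exact ⟨fun i => Fin.cases hnn h0 i, fun i => Fin.cases h2 (fun j => (hle j).trans h2) i⟩

/-- The embedding of `ℝ^d` in `ℝ^{d+1}` as the hyperplane of vanishing first coordinate. -/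
def consZero (d : ℕ) : (Fin d → ℝ) →ₗ[ℝ] (Fin (d + 1) → ℝ) where
  toFun x := Fin.cons 0 x
  map_add' x y := by ext i; refine Fin.cases ?_ (fun j => ?_) i <;> simp
  map_smul' c x := by ext i; refine Fin.cases ?_ (fun j => ?_) i <;> simp

@[simp] theorem consZero_zero (x : Fin d → ℝ) : consZero d x 0 = 0 := rfl

@[simp] theorem consZero_succ (x : Fin d → ℝ) (j : Fin d) : consZero d x j.succ = x j := rfl

/-- The union of the slices `{t} × (t K₀ + L)` for `0 ≤ t ≤ a`. -/
def slabRegion (a : ℝ) (L : Set (Fin d → ℝ)) : Set (Fin (d + 1) → ℝ) :=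
  simplexCone d a + consZero d '' L

theorem convex_slabRegion (a : ℝ) {L : Set (Fin d → ℝ)} (hL : Convex ℝ L) :
    Convex ℝ (slabRegion a L) :=
  (convex_simplexCone a).add (hL.linear_image _)

theorem isCompact_slabRegion (a : ℝ) {L : Set (Fin d → ℝ)} (hL : IsCompact L) :
    IsCompact (slabRegion a L) :=
  (isCompact_simplexCone a).add (hL.image (consZero d).continuous_of_finiteDimensional)

theorem mem_slabRegion {a : ℝ} {L : Set (Fin d → ℝ)} {t : ℝ} {x : Fin d → ℝ} :
    (Fin.cons t x : Fin (d + 1) → ℝ) ∈ slabRegion a L ↔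
      (0 ≤ t ∧ t ≤ a) ∧ x ∈ t • stdK0 d + L := by
  constructor
  · rintro ⟨y, ⟨h0, h1, h2⟩, _, ⟨l, hl, rfl⟩, heq⟩
    have ht : y 0 = t := by simpa using congrFun heq 0
    have hx : ∀ j : Fin d, y j.succ + l j = x j := fun j => by simpa using congrFun heq j.succ
    have hnn : 0 ≤ y 0 := (Finset.sum_nonneg fun j _ => h0 j).trans h1
    subst ht
    exact ⟨⟨hnn, h2⟩, fun j => y j.succ, (mem_smul_stdK0 hnn).2 ⟨h0, h1⟩, l, hl, funext hx⟩
  · rintro ⟨⟨ht, hta⟩, y, hy, l, hl, rfl⟩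
    rw [mem_smul_stdK0 ht] at hy
    refine ⟨Fin.cons t y, ⟨by simpa using hy.1, by simpa using hy.2, by simpa using hta⟩, _,
      ⟨l, hl, rfl⟩, ?_⟩
    ext i
    refine Fin.cases ?_ (fun j => ?_) i <;> simp

end Region

section Volume

variable {d : ℕ}

theorem volume_real_slabRegion {a : ℝ} (ha : 0 ≤ a) {L : Set (Fin d → ℝ)} (hL : IsCompact L) :
    volume.real (slabRegion a L) =
      ∫ t in (0 : ℝ)..a, (volume (t • stdK0 d + L)).toReal := by
  set e := MeasurableEquiv.piFinSuccAbove (fun _ : Fin (d + 1) => ℝ) 0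
  have hmp := volume_preserving_piFinSuccAbove (fun _ : Fin (d + 1) => ℝ) 0
  have hcomp := isCompact_slabRegion a hL
  have hmeas : MeasurableSet (slabRegion a L) := hcomp.measurableSet
  have hmeas' : MeasurableSet (e.symm ⁻¹' slabRegion a L) := e.symm.measurable hmeas
  have hvol : volume (slabRegion a L) = (volume.prod volume) (e.symm ⁻¹' slabRegion a L) :=
    ((hmp.symm).measure_preimage_equiv _).symm
  have hslice : ∀ t : ℝ, volume (Prod.mk t ⁻¹' (e.symm ⁻¹' slabRegion a L)) =
      (Set.Icc 0 a).indicator (fun t => volume (t • stdK0 d + L)) t := by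
    intro t
    have hmem : ∀ x, x ∈ Prod.mk t ⁻¹' (e.symm ⁻¹' slabRegion a L) ↔
        (0 ≤ t ∧ t ≤ a) ∧ x ∈ t • stdK0 d + L := by
      intro x
      rw [← mem_slabRegion, ← Fin.insertNth_zero']
      exact Iff.rfl
    by_cases ht : t ∈ Set.Icc 0 a
    · rw [Set.indicator_of_mem ht]
      congr 1
      ext x
      rw [hmem]
      exact and_iff_right ht
    · rw [Set.indicator_of_notMem ht]
      convert measure_empty (μ := (volume : Measure (Fin d → ℝ)))
      ext x
      rw [hmem]
      exact iff_of_false (fun h => ht h.1) (fun h => h)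
  rw [Measure.prod_apply hmeas'] at hvol
  have hfin : ∫⁻ t, volume (Prod.mk t ⁻¹' (e.symm ⁻¹' slabRegion a L)) ≠ ⊤ :=
    hvol ▸ hcomp.measure_ne_top
  rw [Measure.real, hvol, ← integral_toReal (measurable_measure_prodMk_left hmeas').aemeasurable
    (ae_lt_top (measurable_measure_prodMk_left hmeas') hfin), intervalIntegral.integral_of_le ha,
    ← integral_Icc_eq_integral_Ioc, ← integral_indicator measurableSet_Icc]
  refine integral_congr_ae (Filter.Eventually.of_forall fun t => ?_)
  simp only [hslice]
  by_cases ht : t ∈ Set.Icc 0 a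
  · rw [Set.indicator_of_mem ht, Set.indicator_of_mem ht]
  · rw [Set.indicator_of_notMem ht, Set.indicator_of_notMem ht, ENNReal.toReal_zero]

end Volume

section Counting

variable {d : ℕ}

/-- The lattice `N⁻¹ ℤ^{d+1}`. -/
def scaledLattice (d N : ℕ) : Set (Fin (d + 1) → ℝ) :=
  (N : ℝ)⁻¹ • (Submodule.span ℤ (Set.range (Pi.basisFun ℝ (Fin (d + 1)))) :
    Set (Fin (d + 1) → ℝ))

theorem mem_scaledLattice {N : ℕ} (hN : 0 < N) {y : Fin (d + 1) → ℝ} :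
    y ∈ scaledLattice d N ↔ ∃ z : Fin (d + 1) → ℤ, ∀ i, (z i : ℝ) = N * y i := by
  have : NeZero N := ⟨hN.ne'⟩
  change y ∈ (N : ℝ)⁻¹ • Submodule.span ℤ (Set.range (Pi.basisFun ℝ (Fin (d + 1)))) ↔ _
  rw [BoxIntegral.unitPartition.mem_smul_span_iff]
  exact ⟨fun hy => ⟨fun i => (hy i).choose, fun i => (hy i).choose_spec⟩,
    fun ⟨z, hz⟩ i => ⟨z i, hz i⟩⟩

theorem finite_inter_scaledLattice {N : ℕ} (hN : 0 < N) {s : Set (Fin (d + 1) → ℝ)}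
    (hs : Bornology.IsBounded s) : (s ∩ scaledLattice d N).Finite := by
  obtain ⟨R, hR⟩ := hs.exists_norm_le
  have hN' : (0 : ℝ) < N := by positivity
  refine ((Set.finite_Icc (fun _ : Fin (d + 1) => -⌈N * R⌉) (fun _ => ⌈N * R⌉)).image
    (fun (z : Fin (d + 1) → ℤ) i => (N : ℝ)⁻¹ * (z i : ℝ))).subset ?_
  rintro y ⟨hys, hyl⟩
  obtain ⟨z, hz⟩ := (mem_scaledLattice hN).1 hyl
  have hzR : ∀ i, |z i| ≤ ⌈N * R⌉ := fun i => by
    have h1 : |((z i : ℤ) : ℝ)| ≤ N * R := by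
      rw [hz, abs_mul, abs_of_pos hN']
      gcongr
      exact (norm_le_pi_norm y i).trans (hR y hys)
    exact_mod_cast h1.trans (Int.le_ceil _)
  refine ⟨z, ⟨fun i => (abs_le.1 (hzR i)).1, fun i => (abs_le.1 (hzR i)).2⟩, ?_⟩
  ext i
  simp [hz, hN'.ne']

/-- The point of `ℝ^{d+1}` with first entry the normalized excess degree over `D` and other
entries the normalized first `d` exponents. -/
def rescale (N D : ℕ) (u : Fin (d + 1) →₀ ℕ) : Fin (d + 1) → ℝ :=
  (N : ℝ)⁻¹ • Fin.cons ((u.degree : ℝ) - D) (realProj u)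

theorem rescale_zero (N D : ℕ) (u : Fin (d + 1) →₀ ℕ) :
    rescale N D u 0 = (N : ℝ)⁻¹ * ((u.degree : ℝ) - D) := rfl

theorem rescale_succ (N D : ℕ) (u : Fin (d + 1) →₀ ℕ) (j : Fin d) :
    rescale N D u j.succ = (N : ℝ)⁻¹ * realProj u j := rfl

theorem rescale_injective {N : ℕ} (hN : 0 < N) (D : ℕ) :
    Function.Injective (rescale (d := d) N D) := by
  intro u v huv
  have hN' : (N : ℝ)⁻¹ ≠ 0 := by positivity
  have hcons := smul_right_injective (Fin (d + 1) → ℝ) hN' huv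
  obtain ⟨hdeg, hproj⟩ := Fin.cons_inj.1 hcons
  have hdeg' : (u.degree : ℝ) = v.degree := by linarith
  rw [degree_eq_realProj, degree_eq_realProj, hproj] at hdeg'
  ext i
  refine Fin.lastCases ?_ (fun j => ?_) i
  · exact_mod_cast add_left_cancel hdeg'
  · have := congrFun hproj j
    rw [realProj_apply, realProj_apply] at this
    exact_mod_cast this

variable {r : ℕ} (K : Fin r → Set (Fin d → ℝ)) (h : Fin r → ℕ) (n : Fin r → ℕ)

/-- The exponents of the generators of the product of the `m n_i`-th powers of the ideals
`JIdeal 𝕜 (K i) (h i) p`. -/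
def productExponents (p m : ℕ) : Set (Fin (d + 1) →₀ ℕ) :=
  ∑ i, ∑ _j ∈ Finset.range (m * n i), exponentSet (K i) (h i) p

/-- The degree of the generators of the product of the `m n_i`-th powers of the ideals
`JIdeal 𝕜 (K i) (h i) p`. -/
def productDegree (p m : ℕ) : ℕ := ∑ i, m * n i * (p * h i)

/-- The exponents of the monomials that survive in the quotient. -/
def quotientExponents (n0 p m : ℕ) : Set (Fin (d + 1) →₀ ℕ) :=
  {u | (∃ s ∈ productExponents K h n p m, s ≤ u) ∧
    u.degree < productDegree h n p m + m * (p * n0)}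

variable {K h n}

theorem degree_of_mem_productExponents (hh : ∀ i, 0 < h i) {p m : ℕ} (hp : 0 < p)
    {s : Fin (d + 1) →₀ ℕ} (hs : s ∈ productExponents K h n p m) :
    s.degree = productDegree h n p m := by
  obtain ⟨g, hg, rfl⟩ := (Set.mem_fintype_sum _ _).1 hs
  rw [map_sum]
  exact Finset.sum_congr rfl fun i _ =>
    degree_of_mem_sum (fun u hu => ((mem_exponentSet (hh i) hp).1 hu).2) (hg i)

theorem realProj_of_mem_productExponents (hK : ∀ i, Convex ℝ (K i)) (hne : ∀ i, (K i).Nonempty)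
    (hh : ∀ i, 0 < h i) {p m : ℕ} (hp : 0 < p)
    {s : Fin (d + 1) →₀ ℕ} (hs : s ∈ productExponents K h n p m) :
    realProj s ∈ ((m * p : ℕ) : ℝ) • ∑ i, (n i : ℝ) • K i := by
  obtain ⟨g, hg, rfl⟩ := (Set.mem_fintype_sum _ _).1 hs
  rw [map_sum, Finset.smul_sum, Set.mem_fintype_sum]
  refine ⟨fun i => realProj (g i), fun i => ?_, rfl⟩
  have := realProj_of_mem_sum (hK i) (hne i)
    (fun u hu => ((mem_exponentSet (hh i) hp).1 hu).1) _ (hg i)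
  rw [smul_smul]
  convert this using 2
  push_cast
  ring

theorem quotDim_eq_card_quotientExponents (𝕜 : Type*) [Field 𝕜] (hh : ∀ i, 0 < h i)
    (n0 : ℕ) {p : ℕ} (m : ℕ) (hp : 0 < p) :
    quotDim 𝕜 (∏ i, JIdeal 𝕜 (K i) (h i) p ^ (m * n i))
      (mId 𝕜 (d + 1) ^ (m * (p * n0)) * ∏ i, JIdeal 𝕜 (K i) (h i) p ^ (m * n i)) =
      Nat.card (quotientExponents K h n n0 p m) := by
  have hprod : ∏ i, JIdeal 𝕜 (K i) (h i) p ^ (m * n i) =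
      monomialIdeal 𝕜 (productExponents K h n p m) :=
    prod_monomialIdeal_pow (fun i => exponentSet (K i) (h i) p) fun i => m * n i
  rw [hprod]
  exact quotDim_monomialIdeal _ _ _ _ fun s hs => degree_of_mem_productExponents hh hp hs

theorem rescale_mem_slabRegion (hK : ∀ i, Convex ℝ (K i)) (hne : ∀ i, (K i).Nonempty)
    (hh : ∀ i, 0 < h i) (n0 : ℕ) {p m : ℕ} (hp : 0 < p) (hm : 0 < m) {u : Fin (d + 1) →₀ ℕ}
    (hu : u ∈ quotientExponents K h n n0 p m) :
    rescale (m * p) (productDegree h n p m) u ∈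
      slabRegion (n0 : ℝ) (∑ i, (n i : ℝ) • K i) ∩ scaledLattice d (m * p) := by
  have hN : 0 < m * p := by positivity
  have hN' : (0 : ℝ) < ((m * p : ℕ) : ℝ) := by exact_mod_cast hN
  obtain ⟨⟨s, hs, hsu⟩, hdeg⟩ := hu
  constructor
  · obtain ⟨w, rfl⟩ := exists_add_of_le hsu
    have hsd := degree_of_mem_productExponents hh hp hs
    obtain ⟨l, hl, hls⟩ := realProj_of_mem_productExponents hK hne hh hp hs
    have hw : (w.degree : ℝ) ≤ ((m * p : ℕ) : ℝ) * n0 := by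
      rw [map_add, hsd, ← mul_assoc] at hdeg
      exact_mod_cast (by omega : w.degree ≤ m * p * n0)
    have hw0 : ∀ j, 0 ≤ realProj w j := fun j => by rw [realProj_apply]; positivity
    refine ⟨((m * p : ℕ) : ℝ)⁻¹ • Fin.cons (w.degree : ℝ) (realProj w), ⟨fun j => ?_, ?_, ?_⟩, _,
      ⟨l, hl, rfl⟩, ?_⟩
    · have := hw0 j
      simp only [Pi.smul_apply, Fin.cons_succ, smul_eq_mul]
      positivity
    · simp only [Pi.smul_apply, Fin.cons_succ, Fin.cons_zero, smul_eq_mul, ← Finset.mul_sum]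
      gcongr
      rw [degree_eq_realProj w]
      have : (0 : ℝ) ≤ w (Fin.last d) := by positivity
      linarith
    · simp only [Pi.smul_apply, Fin.cons_zero, smul_eq_mul]
      rwa [inv_mul_le_iff₀ hN']
    · ext i
      refine Fin.cases ?_ (fun j => ?_) i
      · rw [rescale_zero, map_add, hsd]
        simp
      · rw [rescale_succ, map_add, ← hls]
        simp only [Pi.add_apply, Pi.smul_apply, Fin.cons_succ, smul_eq_mul, consZero_succ]
        field_simp
        ring
  · rw [mem_scaledLattice hN]
    refine ⟨Fin.cons ((u.degree : ℤ) - productDegree h n p m) fun j => (u j.castSucc : ℤ),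
      fun i => ?_⟩
    refine Fin.cases ?_ (fun j => ?_) i
    · rw [rescale_zero, mul_inv_cancel_left₀ hN'.ne']
      simp
    · rw [rescale_succ, mul_inv_cancel_left₀ hN'.ne']
      simp [realProj_apply]

/-- The center of the homotheties shrinking the slab region. -/
def slabCenter (n0 : ℕ) (n : Fin r → ℕ) (c : Fin r → Fin d → ℝ) : Fin (d + 1) → ℝ :=
  Fin.cons ((n0 : ℝ) / 2) (∑ i, (n i : ℝ) • c i)

theorem closedBall_homothety_subset {E : Type*} [NormedAddCommGroup E] [NormedSpace ℝ E]
    {s : Set E} (hs : Convex ℝ s) {c k : E} {ρ δ θ : ℝ} (hc : Metric.closedBall c ρ ⊆ s)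
    (hk : k ∈ s) (hθ0 : 0 ≤ θ) (hθ1 : θ < 1) (hδ : δ ≤ (1 - θ) * ρ) :
    Metric.closedBall ((1 - θ) • c + θ • k) δ ⊆ s := by
  intro z hz
  have h1 : 0 < 1 - θ := by linarith
  have hmem : c + (1 - θ)⁻¹ • (z - ((1 - θ) • c + θ • k)) ∈ s := by
    refine hc ?_
    rw [Metric.mem_closedBall, dist_eq_norm, add_sub_cancel_left, norm_smul, norm_inv,
      Real.norm_of_nonneg h1.le, inv_mul_le_iff₀ h1]
    rw [Metric.mem_closedBall, dist_eq_norm] at hz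
    exact hz.trans hδ
  have := hs hmem hk h1.le hθ0 (by ring)
  rw [smul_add, smul_inv_smul₀ h1.ne'] at this
  convert this using 1
  abel

theorem exists_rescale_eq (hK : ∀ i, Convex ℝ (K i)) (hh : ∀ i, SuitableDeg (K i) (h i))
    {n0 : ℕ} (hn0 : 0 < n0) {c : Fin r → Fin d → ℝ} {ρ : Fin r → ℝ} {θ : ℝ}
    (hc : ∀ i, Metric.closedBall (c i) (ρ i) ⊆ K i) (hθ0 : 0 ≤ θ) (hθ1 : θ < 1) {p m : ℕ}
    (hp : 0 < p) (hm : 0 < m) (hpρ : ∀ i, (p : ℝ)⁻¹ ≤ (1 - θ) * ρ i)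
    (hmp : (d * r : ℝ) ≤ (m * p : ℕ) * ((1 - θ) * (n0 / 2))) {y : Fin (d + 1) → ℝ}
    (hy : y ∈ AffineMap.homothety (slabCenter n0 n c) θ ''
      slabRegion (n0 : ℝ) (∑ i, (n i : ℝ) • K i) ∩ scaledLattice d (m * p)) :
    ∃ u ∈ quotientExponents K h n n0 p m, rescale (m * p) (productDegree h n p m) u = y := by
  have hN : 0 < m * p := by positivity
  have hN' : (0 : ℝ) < ((m * p : ℕ) : ℝ) := by exact_mod_cast hN
  obtain ⟨⟨_, ⟨τ, ⟨hτ0, hτ1, hτ2⟩, _, ⟨l, hl, rfl⟩, rfl⟩, rfl⟩, hlat⟩ := hy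
  obtain ⟨g, hg, rfl⟩ := (Set.mem_fintype_sum _ _).1 hl
  choose k hk hkg using hg
  simp only at hkg
  set q : Fin r → Fin d → ℝ := fun i => (1 - θ) • c i + θ • k i with hq
  set y := AffineMap.homothety (slabCenter n0 n c) θ (τ + consZero d (∑ i, g i)) with hydef
  have hy0 : y 0 = (1 - θ) * (n0 / 2) + θ * τ 0 := by
    simp only [hydef, AffineMap.homothety_apply, slabCenter, vsub_eq_sub, vadd_eq_add,
      Pi.add_apply, Pi.smul_apply, Pi.sub_apply, Fin.cons_zero, consZero_zero, smul_eq_mul]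
    ring
  have hyj : ∀ j : Fin d, y j.succ = θ * τ j.succ + ∑ i, (n i : ℝ) * q i j := by
    intro j
    simp only [hydef, AffineMap.homothety_apply, slabCenter, vsub_eq_sub, vadd_eq_add, hq,
      Pi.add_apply, Pi.smul_apply, Pi.sub_apply, Fin.cons_succ, consZero_succ, smul_eq_mul,
      Finset.sum_apply, ← hkg, mul_add, Finset.sum_add_distrib, Finset.mul_sum, mul_sub]
    rw [Finset.sum_congr rfl fun i _ => show (n i : ℝ) * ((1 - θ) * c i j) =
      n i * c i j - θ * (n i * c i j) by ring, Finset.sum_sub_distrib,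
      Finset.sum_congr rfl fun i _ => show (n i : ℝ) * (θ * k i j) = θ * (n i * k i j) by ring]
    ring
  obtain ⟨z, hz⟩ := (mem_scaledLattice hN).1 hlat
  have hball : ∀ i, Metric.closedBall (q i) (p : ℝ)⁻¹ ⊆ K i := fun i =>
    closedBall_homothety_subset (hK i) (hc i) (hk i) hθ0 hθ1 (hpρ i)
  choose v hv hvp using fun i =>
    exists_mem_sum_exponentSet hp (hh i) (q i) (hball i) (m * n i)
  have hτnn : 0 ≤ τ 0 := (Finset.sum_nonneg fun j _ => hτ0 j).trans hτ1
  have hz0 : 0 ≤ z 0 := by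
    have : (0 : ℝ) ≤ z 0 := by
      rw [hz, hy0]
      have : 0 < 1 - θ := by linarith
      positivity
    exact_mod_cast this
  obtain ⟨t, ht⟩ := Int.eq_ofNat_of_zero_le hz0
  have htr : (t : ℝ) = (m * p : ℕ) * y 0 := by rw [← hz, ht]; simp
  set A : Fin d → ℤ := fun j => ∑ i, ⌊((m * n i : ℕ) : ℝ) * (p * q i j)⌋ with hA
  have hAle : ∀ j, (A j : ℝ) ≤ (m * p : ℕ) * ∑ i, (n i : ℝ) * q i j := fun j => by
    rw [hA, Finset.mul_sum]
    push_cast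
    refine Finset.sum_le_sum fun i _ => (Int.floor_le _).trans (le_of_eq ?_)
    ring
  have hleA : ∀ j, (m * p : ℕ) * ∑ i, (n i : ℝ) * q i j ≤ A j + r := fun j => by
    have hr : (r : ℝ) = ∑ _i : Fin r, (1 : ℝ) := by simp
    rw [hA, Finset.mul_sum, hr]
    push_cast
    rw [← Finset.sum_add_distrib]
    refine Finset.sum_le_sum fun i _ => (le_of_eq ?_).trans (Int.lt_floor_add_one _).le
    ring
  have hb0 : ∀ j : Fin d, 0 ≤ z j.succ - A j := fun j => by
    have : (0 : ℝ) ≤ z j.succ - A j := by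
      rw [hz, hyj]
      have h1 := hAle j
      have h2 : 0 ≤ ((m * p : ℕ) : ℝ) * (θ * τ j.succ) := by
        have := hτ0 j
        positivity
      linarith
    exact_mod_cast this
  have hbt : ∑ j : Fin d, (z j.succ - A j) ≤ t := by
    have : ∑ j : Fin d, ((z j.succ : ℝ) - A j) ≤ t := by
      calc ∑ j : Fin d, ((z j.succ : ℝ) - A j)
          ≤ ∑ j : Fin d, ((m * p : ℕ) * (θ * τ j.succ) + r) := by
            refine Finset.sum_le_sum fun j _ => ?_
            rw [hz, hyj]
            linarith [hleA j]
        _ = (m * p : ℕ) * (θ * ∑ j : Fin d, τ j.succ) + d * r := by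
            rw [Finset.sum_add_distrib, ← Finset.mul_sum, ← Finset.mul_sum]
            simp
        _ ≤ (m * p : ℕ) * (θ * τ 0) + (m * p : ℕ) * ((1 - θ) * (n0 / 2)) := by gcongr
        _ = t := by rw [htr, hy0]; ring
    exact_mod_cast this
  obtain ⟨w, hw, hwd⟩ := exists_exponent (fun j => z j.succ - A j) t hb0 hbt
  have hs : ∑ i, v i ∈ productExponents K h n p m :=
    (Set.mem_fintype_sum _ _).2 ⟨v, hv, rfl⟩
  have hsd := degree_of_mem_productExponents (fun i => (hh i).1) hp hs
  have htlt : t < m * (p * n0) := by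
    have : (t : ℝ) < (m * p : ℕ) * n0 := by
      rw [htr, hy0]
      gcongr
      have h1 : 0 < 1 - θ := by linarith
      have h2 : (0 : ℝ) < n0 := by positivity
      nlinarith [mul_le_mul_of_nonneg_left hτ2 hθ0, mul_pos h1 h2]
    rw [← mul_assoc]
    exact_mod_cast this
  refine ⟨∑ i, v i + w, ⟨⟨_, hs, le_self_add⟩, ?_⟩, ?_⟩
  · rw [map_add, hsd, hwd]
    omega
  · ext i
    refine Fin.cases ?_ (fun j => ?_) i
    · rw [rescale_zero, map_add, hsd, hwd, Nat.cast_add, add_sub_cancel_left, htr,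
        inv_mul_cancel_left₀ hN'.ne']
    · rw [rescale_succ, map_add, map_sum, hw, Pi.add_apply, Finset.sum_apply]
      simp_rw [hvp]
      rw [← Int.cast_sum, ← Int.cast_add, add_sub_cancel, hz, inv_mul_cancel_left₀ hN'.ne']

end Counting

section Limits

variable {d r : ℕ} {K : Fin r → Set (Fin d → ℝ)} {h : Fin r → ℕ} {n : Fin r → ℕ}

theorem tendsto_card_inter_scaledLattice {s : Set (Fin (d + 1) → ℝ)} (hs : IsCompact s)
    (hconv : Convex ℝ s) {p : ℕ} (hp : 0 < p) :
    Tendsto (fun m : ℕ => (Nat.card ↑(s ∩ scaledLattice d (m * p)) : ℝ) / (m : ℝ) ^ (d + 1))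
      atTop (nhds ((p : ℝ) ^ (d + 1) * volume.real s)) := by
  have hp' : (p : ℝ) ≠ 0 := by positivity
  have h1 : Tendsto (fun N : ℕ => (Nat.card ↑(s ∩ scaledLattice d N) : ℝ) / (N : ℝ) ^ (d + 1))
      atTop (nhds (volume.real s)) := by
    have := tendsto_card_div_pow_atTop_volume s hs.isBounded hs.measurableSet
      (hconv.addHaar_frontier volume)
    rw [Fintype.card_fin] at this
    exact this
  have h2 : Tendsto (fun m : ℕ => m * p) atTop atTop := tendsto_id.atTop_mul_const' hp
  refine ((h1.comp h2).const_mul ((p : ℝ) ^ (d + 1))).congr fun m => ?_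
  simp only [Function.comp_apply]
  generalize (Nat.card ↑(s ∩ scaledLattice d (m * p)) : ℝ) = a
  rw [Nat.cast_mul, mul_pow, ← mul_div_assoc, mul_comm ((p : ℝ) ^ (d + 1)),
    mul_div_mul_right _ _ (by positivity)]

theorem convex_sum_smul (hK : ∀ i, Convex ℝ (K i)) : Convex ℝ (∑ i, (n i : ℝ) • K i) :=
  convex_sum _ fun i _ => (hK i).smul _

theorem isCompact_sum_smul (hK : ∀ i, IsCompact (K i)) (a : Fin r → ℝ) :
    IsCompact (∑ i, a i • K i) :=
  Finset.sum_induction _ IsCompact (fun _ _ hs ht => hs.add ht) isCompact_singleton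
    fun i _ => (hK i).smul (a i)

theorem card_quotientExponents_le (hK : ∀ i, IsConvexBody (K i)) (hh : ∀ i, SuitableDeg (K i) (h i))
    (n0 : ℕ) {p m : ℕ} (hp : 0 < p) (hm : 0 < m) :
    Nat.card (quotientExponents K h n n0 p m) ≤
      Nat.card ↑(slabRegion (n0 : ℝ) (∑ i, (n i : ℝ) • K i) ∩ scaledLattice d (m * p)) := by
  have hN : 0 < m * p := by positivity
  rw [Nat.card_coe_set_eq, Nat.card_coe_set_eq,
    ← Set.ncard_image_of_injective _ (rescale_injective hN (productDegree h n p m))]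
  refine Set.ncard_le_ncard ?_ (finite_inter_scaledLattice hN
    (isCompact_slabRegion _ (isCompact_sum_smul (fun i => (hK i).2.1) _)).isBounded)
  rintro _ ⟨u, hu, rfl⟩
  exact rescale_mem_slabRegion (fun i => (hK i).1)
    (fun i => (hK i).2.2.mono interior_subset) (fun i => (hh i).1) n0 hp hm hu

theorem card_le_card_quotientExponents (hK : ∀ i, Convex ℝ (K i))
    (hh : ∀ i, SuitableDeg (K i) (h i)) {n0 : ℕ} (hn0 : 0 < n0) {c : Fin r → Fin d → ℝ}
    {ρ : Fin r → ℝ} {θ : ℝ} (hc : ∀ i, Metric.closedBall (c i) (ρ i) ⊆ K i) (hθ0 : 0 ≤ θ)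
    (hθ1 : θ < 1) {p m : ℕ} (hp : 0 < p) (hm : 0 < m) (hpρ : ∀ i, (p : ℝ)⁻¹ ≤ (1 - θ) * ρ i)
    (hmp : (d * r : ℝ) ≤ (m * p : ℕ) * ((1 - θ) * (n0 / 2))) :
    Nat.card ↑(AffineMap.homothety (slabCenter n0 n c) θ ''
      slabRegion (n0 : ℝ) (∑ i, (n i : ℝ) • K i) ∩ scaledLattice d (m * p)) ≤
      Nat.card (quotientExponents K h n n0 p m) := by
  have hN : 0 < m * p := by positivity
  have hfin : (quotientExponents K h n n0 p m).Finite :=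
    (Finsupp.finite_of_degree_le (productDegree h n p m + m * (p * n0))).subset
      fun u hu => hu.2.le
  rw [Nat.card_coe_set_eq, Nat.card_coe_set_eq,
    ← Set.ncard_image_of_injective _ (rescale_injective hN (productDegree h n p m))]
  exact Set.ncard_le_ncard
    (fun y hy => exists_rescale_eq hK hh hn0 hc hθ0 hθ1 hp hm hpρ hmp hy) (hfin.image _)

theorem tendsto_volume_slabRegion (hK : ∀ i, IsConvexBody (K i))
    (hh : ∀ i, SuitableDeg (K i) (h i)) {n0 : ℕ} (hn0 : 0 < n0) (g : ℕ → ℝ)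
    (hg : ∀ p : ℕ, 0 < p → Tendsto
      (fun m : ℕ => (Nat.card (quotientExponents K h n n0 p m) : ℝ) / (m : ℝ) ^ (d + 1))
      atTop (nhds ((p : ℝ) ^ (d + 1) * g p))) :
    Tendsto g atTop (nhds (volume.real (slabRegion (n0 : ℝ) (∑ i, (n i : ℝ) • K i)))) := by
  set s := slabRegion (n0 : ℝ) (∑ i, (n i : ℝ) • K i)
  have hcomp : IsCompact s :=
    isCompact_slabRegion _ (isCompact_sum_smul (fun i => (hK i).2.1) _)
  have hconv : Convex ℝ s := convex_slabRegion _ (convex_sum_smul fun i => (hK i).1)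
  have hcentre : ∀ i, ∃ c : Fin d → ℝ, ∃ ρ : ℝ, 0 < ρ ∧ Metric.closedBall c ρ ⊆ K i := by
    intro i
    obtain ⟨c, hc⟩ := (hK i).2.2
    obtain ⟨ρ, hρ, hsub⟩ := Metric.nhds_basis_closedBall.mem_iff.1 (mem_interior_iff_mem_nhds.1 hc)
    exact ⟨c, ρ, hρ, hsub⟩
  choose c ρ hρ hc using hcentre
  have hupper : ∀ p : ℕ, 0 < p → g p ≤ volume.real s := by
    intro p hp
    have hp' : (0 : ℝ) < (p : ℝ) ^ (d + 1) := by positivity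
    refine le_of_mul_le_mul_left ?_ hp'
    refine le_of_tendsto_of_tendsto (hg p hp) (tendsto_card_inter_scaledLattice hcomp hconv hp) ?_
    filter_upwards [eventually_gt_atTop 0] with m hm
    gcongr
    exact card_quotientExponents_le hK hh n0 hp hm
  have hlower : ∀ θ : ℝ, 0 ≤ θ → θ < 1 →
      ∀ᶠ p : ℕ in atTop, θ ^ (d + 1) * volume.real s ≤ g p := by
    intro θ hθ0 hθ1
    have h1 : 0 < 1 - θ := by linarith
    have hev : ∀ᶠ p : ℕ in atTop, ∀ i, (p : ℝ)⁻¹ ≤ (1 - θ) * ρ i := by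
      rw [Filter.eventually_all]
      intro i
      exact (tendsto_inv_atTop_nhds_zero_nat (𝕜 := ℝ)).eventually_le_const (mul_pos h1 (hρ i))
    filter_upwards [hev, eventually_gt_atTop 0] with p hpρ hp
    have hp' : (0 : ℝ) < (p : ℝ) ^ (d + 1) := by positivity
    refine le_of_mul_le_mul_left ?_ hp'
    have hvol : volume.real (AffineMap.homothety (slabCenter n0 n c) θ '' s) =
        θ ^ (d + 1) * volume.real s := by
      rw [Measure.real, Measure.addHaar_image_homothety, ENNReal.toReal_mul,
        ENNReal.toReal_ofReal (abs_nonneg _), abs_of_nonneg (by positivity)]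
      simp [Measure.real]
    rw [← hvol]
    refine le_of_tendsto_of_tendsto (tendsto_card_inter_scaledLattice
      (hcomp.image (AffineMap.homothety_continuous _ _)) (hconv.affine_image _) hp) (hg p hp) ?_
    have hlarge : Tendsto (fun m : ℕ => ((m * p : ℕ) : ℝ) * ((1 - θ) * (n0 / 2))) atTop atTop := by
      refine Tendsto.atTop_mul_const (by positivity) ?_
      exact tendsto_natCast_atTop_atTop.comp (tendsto_id.atTop_mul_const' hp)
    filter_upwards [eventually_gt_atTop 0, hlarge.eventually_ge_atTop (d * r : ℝ)] with m hm hmp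
    gcongr
    exact card_le_card_quotientExponents (fun i => (hK i).1) hh hn0 hc hθ0 hθ1 hp hm hpρ hmp
  refine tendsto_order.2 ⟨fun b hb => ?_, fun b hb => ?_⟩
  · have hcont : Tendsto (fun θ : ℝ => θ ^ (d + 1) * volume.real s) (nhdsWithin 1 (Set.Iio 1))
        (nhds (volume.real s)) := by
      have : Continuous fun θ : ℝ => θ ^ (d + 1) * volume.real s := by fun_prop
      simpa using (this.tendsto 1).mono_left nhdsWithin_le_nhds
    obtain ⟨θ, hθb, hθ⟩ := ((hcont.eventually_const_lt hb).and
      (Ico_mem_nhdsLT (zero_lt_one' ℝ))).exists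
    exact (hlower θ hθ.1 hθ.2).mono fun p hp => hθb.trans_le hp
  · filter_upwards [eventually_gt_atTop 0] with p hp
    exact (hupper p hp).trans_lt hb

end Limits

section Polynomials

variable {k : ℕ}

/-- In a finite-dimensional space of polynomials, sequences that converge pointwise on an infinite
grid converge under every linear functional. -/
theorem tendsto_linear_of_tendsto_eval (V : Submodule ℝ (MvPolynomial (Fin k) ℝ))
    [FiniteDimensional ℝ V] (s : Fin k → Set ℝ) (hs : ∀ i, (s i).Infinite) (P : ℕ → V) (P₀ : V)
    (hP : ∀ x ∈ Set.pi Set.univ s, Tendsto (fun p => MvPolynomial.eval x (P p).1) atTop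
      (nhds (MvPolynomial.eval x P₀.1)))
    (φ : MvPolynomial (Fin k) ℝ →ₗ[ℝ] ℝ) :
    Tendsto (fun p => φ (P p).1) atTop (nhds (φ P₀.1)) := by
  let ev : (Fin k → ℝ) → Module.Dual ℝ V := fun x =>
    (MvPolynomial.aeval x : MvPolynomial (Fin k) ℝ →ₐ[ℝ] ℝ).toLinearMap ∘ₗ V.subtype
  have hev : ∀ x f, ev x f = MvPolynomial.eval x f.1 := fun x f => by
    simp [ev]
  set W : Submodule ℝ (Module.Dual ℝ V) := Submodule.span ℝ (ev '' Set.pi Set.univ s)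
  have hbot : W.dualCoannihilator = ⊥ := by
    rw [eq_bot_iff]
    intro f hf
    rw [Submodule.mem_dualCoannihilator] at hf
    have : f.1 = 0 := by
      refine MvPolynomial.funext_set s hs fun x hx => ?_
      rw [← hev, hf _ (Submodule.subset_span ⟨x, hx, rfl⟩), map_zero]
    exact Subtype.ext this
  have htop : W = ⊤ := by
    have h1 := Subspace.finrank_add_finrank_dualCoannihilator_eq W
    rw [hbot, finrank_bot, add_zero] at h1
    exact Submodule.eq_top_of_finrank_eq (h1.trans Subspace.dual_finrank_eq.symm)
  have hall : ∀ ψ ∈ W, Tendsto (fun p => ψ (P p)) atTop (nhds (ψ P₀)) := by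
    intro ψ hψ
    induction hψ using Submodule.span_induction with
    | mem ψ hψ =>
      obtain ⟨x, hx, rfl⟩ := hψ
      simpa only [hev] using hP x hx
    | zero => simp
    | add a b _ _ ha hb => simpa using ha.add hb
    | smul c a _ ha => simpa using ha.const_mul c
  exact hall (φ ∘ₗ V.subtype) (htop ▸ Submodule.mem_top)

/-- The substitution `X_i ↦ c_i X_i`. -/
def diagScale (c : Fin k → ℝ) (P : MvPolynomial (Fin k) ℝ) : MvPolynomial (Fin k) ℝ :=
  ∑ a ∈ P.support, MvPolynomial.monomial a (P.coeff a * ∏ i, c i ^ a i)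

theorem eval_diagScale (c x : Fin k → ℝ) (P : MvPolynomial (Fin k) ℝ) :
    MvPolynomial.eval x (diagScale c P) = MvPolynomial.eval (fun i => c i * x i) P := by
  rw [diagScale, map_sum, MvPolynomial.eval_eq']
  refine Finset.sum_congr rfl fun a _ => ?_
  rw [MvPolynomial.eval_monomial, Finsupp.prod_fintype _ _ (fun i => pow_zero _), mul_assoc,
    ← Finset.prod_mul_distrib]
  simp_rw [mul_pow]

theorem coeff_diagScale (c : Fin k → ℝ) (P : MvPolynomial (Fin k) ℝ) (a : Fin k →₀ ℕ) :
    (diagScale c P).coeff a = P.coeff a * ∏ i, c i ^ a i := by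
  classical
  rw [diagScale, MvPolynomial.coeff_sum]
  simp only [MvPolynomial.coeff_monomial]
  rw [Finset.sum_ite_eq' P.support a]
  split_ifs with ha
  · rfl
  · rw [MvPolynomial.notMem_support_iff.1 ha, zero_mul]

theorem totalDegree_diagScale_le (c : Fin k → ℝ) (P : MvPolynomial (Fin k) ℝ) :
    (diagScale c P).totalDegree ≤ P.totalDegree := by
  refine Finset.sup_mono fun a ha => ?_
  rw [MvPolynomial.mem_support_iff, coeff_diagScale] at ha
  exact MvPolynomial.mem_support_iff.2 (left_ne_zero_of_mul ha)

/-- The antiderivative in the first variable that vanishes where this variable does. -/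
def antideriv (P : MvPolynomial (Fin (k + 1)) ℝ) : MvPolynomial (Fin (k + 1)) ℝ :=
  ∑ a ∈ P.support, MvPolynomial.monomial (a + Finsupp.single 0 1) (P.coeff a / (a 0 + 1))

theorem eval_antideriv (P : MvPolynomial (Fin (k + 1)) ℝ) (t : ℝ) (x : Fin k → ℝ) :
    MvPolynomial.eval (Fin.cons t x : Fin (k + 1) → ℝ) (antideriv P) =
      ∫ s in (0 : ℝ)..t, MvPolynomial.eval (Fin.cons s x : Fin (k + 1) → ℝ) P := by
  have hP (u : ℝ) := MvPolynomial.eval_eq' (Fin.cons u x : Fin (k + 1) → ℝ) P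
  simp_rw [hP]
  rw [intervalIntegral.integral_finsetSum]
  · rw [antideriv, map_sum]
    refine Finset.sum_congr rfl fun a _ => ?_
    simp only [MvPolynomial.eval_monomial, Fin.prod_univ_succ, Fin.cons_zero, Fin.cons_succ]
    rw [Finsupp.prod_fintype _ _ (fun i => pow_zero _), Fin.prod_univ_succ]
    simp only [Fin.cons_zero, Fin.cons_succ, Finsupp.add_apply, Finsupp.single_eq_same,
      intervalIntegral.integral_const_mul, intervalIntegral.integral_mul_const, integral_pow]
    have h0 : (a 0 : ℝ) + 1 ≠ 0 := by positivity
    simp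
    field_simp
  · intro a _
    simp only [Fin.prod_univ_succ, Fin.cons_zero, Fin.cons_succ]
    exact Continuous.intervalIntegrable (by fun_prop) _ _

theorem coeff_antideriv (P : MvPolynomial (Fin (k + 1)) ℝ) (a : Fin (k + 1) →₀ ℕ) :
    (antideriv P).coeff (a + Finsupp.single 0 1) = P.coeff a / (a 0 + 1) := by
  classical
  rw [antideriv, MvPolynomial.coeff_sum]
  simp only [MvPolynomial.coeff_monomial, add_left_inj]
  rw [Finset.sum_ite_eq' P.support a]
  split_ifs with ha
  · rfl
  · rw [MvPolynomial.notMem_support_iff.1 ha, zero_div]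

theorem eval_smul_of_isHomogeneous {P : MvPolynomial (Fin k) ℝ} {e : ℕ} (hP : P.IsHomogeneous e)
    (c : ℝ) (x : Fin k → ℝ) :
    MvPolynomial.eval (fun i => c * x i) P = c ^ e * MvPolynomial.eval x P := by
  rw [MvPolynomial.eval_eq', MvPolynomial.eval_eq', Finset.mul_sum]
  refine Finset.sum_congr rfl fun a ha => ?_
  have hdeg : ∑ i, a i = e := by
    rw [← Finsupp.degree_eq_sum, Finsupp.degree_eq_weight_one]
    exact hP (MvPolynomial.mem_support_iff.1 ha)
  simp_rw [mul_pow]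
  rw [Finset.prod_mul_distrib, Finset.prod_pow_eq_pow_sum, hdeg]
  ring

end Polynomials

/-- **Normalized limits of mixed multiplicities of the ideals `J(i)_p` compute mixed volumes.**
For `p ≥ 1` let `G_p` be the homogeneous degree-`(d+1)` polynomial with
`G_p(n₀,𝐧) = lim_m dim_𝕜(𝐉(p)^{m𝐧}/𝔪^{mn₀}𝐉(p)^{m𝐧})/m^{d+1}`.  Then for all
`λ₀, …, λ_r ≥ 0`, `G_p(λ₀, λ₁/p, …, λ_r/p) → ∫_0^{λ₀} Vol_d(tK₀ + λ₁K₁ + ⋯ + λ_rK_r) dt`;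
equivalently, for each `(d₀,𝐝)` with `d₀ + |𝐝| = d`, the normalized mixed multiplicities
`e_{(d₀,𝐝)}(𝔪|J(1)_p,…,J(r)_p)/p^{|𝐝|}` converge to the mixed volume
`MV_d(K₀ (d₀ times), K_i (d_i times))`, where the mixed volumes are normalized as the
coefficients of the volume polynomial `Q(λ) = Vol_d(λ₀K₀+⋯+λ_rK_r)`. -/
theorem statement16 {𝕜 : Type*} [Field 𝕜] (d r : ℕ)
    (K : Fin r → Set (Fin d → ℝ)) (h : Fin r → ℕ)
    (hK : ∀ i, IsConvexBody (K i) ∧ K i ⊆ {x | ∀ j, 0 ≤ x j})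
    (hh : ∀ i, SuitableDeg (K i) (h i))
    (Gp : ℕ → MvPolynomial (Fin (r + 1)) ℝ)
    (hGphom : ∀ p : ℕ, 0 < p → (Gp p).IsHomogeneous (d + 1))
    (hGplim : ∀ p : ℕ, 0 < p → ∀ (n0 : ℕ) (n : Fin r → ℕ),
      Tendsto
        (fun m : ℕ =>
          (quotDim 𝕜 (∏ i, JIdeal 𝕜 (K i) (h i) p ^ (m * n i))
              (mId 𝕜 (d + 1) ^ (m * n0) * ∏ i, JIdeal 𝕜 (K i) (h i) p ^ (m * n i)) : ℝ) /
            (m : ℝ) ^ (d + 1))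
        atTop
        (nhds (MvPolynomial.eval (Fin.cons (n0 : ℝ) fun i => (n i : ℝ)) (Gp p))))
    (Q : MvPolynomial (Fin (r + 1)) ℝ)
    (hQ : ∀ lam : Fin (r + 1) → ℝ, (∀ i, 0 ≤ lam i) →
      MvPolynomial.eval lam Q =
        (MeasureTheory.volume (lam 0 • stdK0 d + ∑ i : Fin r, lam i.succ • K i)).toReal) :
    (∀ lam : Fin (r + 1) → ℝ, (∀ i, 0 ≤ lam i) →
      Tendsto
        (fun p : ℕ =>
          MvPolynomial.eval (Fin.cons (lam 0) fun i => lam i.succ / (p : ℝ)) (Gp p))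
        atTop
        (nhds (∫ t in (0 : ℝ)..(lam 0),
          (MeasureTheory.volume (t • stdK0 d + ∑ i : Fin r, lam i.succ • K i)).toReal))) ∧
    ∀ (d0 : ℕ) (D : Fin r → ℕ), d0 + ∑ i, D i = d →
      Tendsto
        (fun p : ℕ =>
          ((Nat.factorial (d0 + 1) * ∏ i, Nat.factorial (D i) : ℕ) : ℝ) *
              (Gp p).coeff (Finsupp.equivFunOnFinite.symm (Fin.cons (d0 + 1) D)) /
            (p : ℝ) ^ (∑ i, D i))
        atTop
        (nhds (((Nat.factorial d0 * ∏ i, Nat.factorial (D i) : ℕ) : ℝ) *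
          Q.coeff (Finsupp.equivFunOnFinite.symm (Fin.cons d0 D)))) := by
  have hK' : ∀ i, IsConvexBody (K i) := fun i => (hK i).1
  have hvol : ∀ (lam : Fin (r + 1) → ℝ), (∀ i, 0 ≤ lam i) →
      MvPolynomial.eval lam (antideriv Q) = ∫ t in (0 : ℝ)..(lam 0),
        (MeasureTheory.volume (t • stdK0 d + ∑ i : Fin r, lam i.succ • K i)).toReal := by
    intro lam hlam
    rw [← Fin.cons_self_tail lam, eval_antideriv]
    refine intervalIntegral.integral_congr fun t ht => ?_
    rw [Set.uIcc_of_le (hlam 0)] at ht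
    have hnonneg : ∀ i, 0 ≤ (Fin.cons t (Fin.tail lam) : Fin (r + 1) → ℝ) i :=
      Fin.cases ht.1 fun i => hlam i.succ
    simpa [Fin.tail] using hQ _ hnonneg
  set c : ℕ → Fin (r + 1) → ℝ := fun p => Fin.cons 1 fun _ => (p : ℝ)⁻¹
  have hscale : ∀ (p : ℕ) (lam : Fin (r + 1) → ℝ),
      MvPolynomial.eval lam (diagScale (c p) (Gp p)) =
        MvPolynomial.eval (Fin.cons (lam 0) fun i => lam i.succ / (p : ℝ)) (Gp p) := by
    intro p lam
    rw [eval_diagScale]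
    congr 2
    funext i
    refine Fin.cases ?_ (fun i => ?_) i
    · simp [c]
    · simp [c, div_eq_inv_mul]
  have hgrid : ∀ n : Fin (r + 1) → ℕ, 0 < n 0 →
      Tendsto (fun p => MvPolynomial.eval (fun i => (n i : ℝ)) (diagScale (c p) (Gp p))) atTop
        (nhds (MvPolynomial.eval (fun i => (n i : ℝ)) (antideriv Q))) := by
    intro n hn
    rw [hvol _ fun i => Nat.cast_nonneg _, ← volume_real_slabRegion (Nat.cast_nonneg _)
      (isCompact_sum_smul (fun i => (hK' i).2.1) _)]
    refine tendsto_volume_slabRegion (n := fun i => n i.succ) hK' hh hn _ fun p hp => ?_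
    have hp' : (p : ℝ) ≠ 0 := by positivity
    have hlim := hGplim p hp (p * n 0) fun i => n i.succ
    simp_rw [quotDim_eq_card_quotientExponents 𝕜 (fun i => (hh i).1) (n 0) _ hp] at hlim
    convert hlim using 2
    rw [hscale, ← eval_smul_of_isHomogeneous (hGphom p hp)]
    congr 2
    funext i
    refine Fin.cases ?_ (fun i => ?_) i
    · simp
    · simp [mul_div_cancel₀ _ hp']
  have key : ∀ φ : MvPolynomial (Fin (r + 1)) ℝ →ₗ[ℝ] ℝ,
      Tendsto (fun p => φ (diagScale (c p) (Gp p))) atTop (nhds (φ (antideriv Q))) := by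
    intro φ
    set N := max (antideriv Q).totalDegree (d + 1)
    have hmem : ∀ p, diagScale (c (p + 1)) (Gp (p + 1)) ∈
        MvPolynomial.restrictTotalDegree (Fin (r + 1)) ℝ N := fun p =>
      (MvPolynomial.mem_restrictTotalDegree _ _ _).2 <| (totalDegree_diagScale_le _ _).trans <|
        (hGphom _ p.succ_pos).totalDegree_le.trans (le_max_right _ _)
    rw [← tendsto_add_atTop_iff_nat 1]
    refine tendsto_linear_of_tendsto_eval (MvPolynomial.restrictTotalDegree (Fin (r + 1)) ℝ N)
      (fun _ => (fun n : ℕ => ((n + 1 : ℕ) : ℝ)) '' Set.univ)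
      (fun _ => Set.infinite_univ.image
        (Nat.cast_injective.comp (add_left_injective 1)).injOn)
      (fun p => ⟨_, hmem p⟩)
      ⟨_, (MvPolynomial.mem_restrictTotalDegree _ _ _).2 (le_max_left _ _)⟩ (fun x hx => ?_) φ
    choose n _ hn using fun i => hx i (Set.mem_univ i)
    obtain rfl : (fun i => ((n i + 1 : ℕ) : ℝ)) = x := funext hn
    exact (tendsto_add_atTop_iff_nat 1).2 (hgrid (fun i => n i + 1) (n 0).succ_pos)
  refine ⟨fun lam hlam => ?_, fun d0 D _ => ?_⟩
  · have hlim := key (MvPolynomial.aeval lam : MvPolynomial (Fin (r + 1)) ℝ →ₐ[ℝ] ℝ).toLinearMap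
    have heval : ∀ P, (MvPolynomial.aeval lam : MvPolynomial (Fin (r + 1)) ℝ →ₐ[ℝ] ℝ).toLinearMap P
        = MvPolynomial.eval lam P := fun P => by simp
    simpa only [heval, hscale, hvol lam hlam] using hlim
  · set A : Fin (r + 1) →₀ ℕ := Finsupp.equivFunOnFinite.symm (Fin.cons d0 D)
    have hsucc : Finsupp.equivFunOnFinite.symm (Fin.cons (d0 + 1) D) =
        A + Finsupp.single 0 1 := by
      ext i
      refine Fin.cases ?_ (fun i => ?_) i <;> simp [A]
    have hlim := (key (MvPolynomial.lcoeff ℝ (A + Finsupp.single 0 1))).const_mul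
      (((d0 + 1).factorial * ∏ i, (D i).factorial : ℕ) : ℝ)
    simp only [MvPolynomial.lcoeff_apply, coeff_antideriv, coeff_diagScale] at hlim
    rw [hsucc]
    convert hlim using 2
    · simp [c, A, Fin.prod_univ_succ, Finset.prod_pow_eq_pow_sum, div_eq_mul_inv, mul_assoc]
    · have h0 : (d0 : ℝ) + 1 ≠ 0 := by positivity
      simp only [A, Nat.factorial_succ, Finsupp.equivFunOnFinite_symm_apply_apply, Fin.cons_zero]
      push_cast
      field_simp
end
end

section
/- For each positive integer p and each 1 ≤ i ≤ r, let K_i(p) ⊂ ℝ^d be the lattice polytope K_i(p) = π_1( conv{ 𝐦 ∈ ℕ^{d+1} : x^𝐦 ∈ [J(i)_p]_{p·h_{K_i}} } ), where [J(i)_p]_{p·h_{K_i}} denotes the degree-(p·h_{K_i}) graded piece of the ideal J(i)_p. Then for every λ = (λ_0,λ_1,…,λ_r) ∈ ℝ^{r+1}_{≥0}, lim_{p→∞} Vol_d( λ_0K_0 + (λ_1/p)K_1(p) + ⋯ + (λ_r/p)K_r(p) ) = Vol_d( λ_0K_0 + λ_1K_1 + ⋯ + λ_rK_r ); equivalently,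 for each (d_0,𝐝) ∈ ℕ^{r+1} with d_0+|𝐝| = d, the mixed volume of the multiset of d_0 copies of K_0 and d_i copies of K_i(p), normalized by p^{|𝐝|}, converges to the mixed volume of the multiset of d_0 copies of K_0 and d_i copies of K_i. -/
open Filter MvPolynomial Pointwise MeasureTheory

noncomputable section

/-- The lattice polytope `K_i(p) = π₁(conv{𝐦 ∈ ℕ^{d+1} : x^𝐦 ∈ [J(i)_p]_{p·h_i}})` spanned by
the generators of `J(i)_p`. -/
def KPoly (𝕜 : Type*) [Field 𝕜] {d : ℕ} (K : Set (Fin d → ℝ)) (h p : ℕ) :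
    Set (Fin d → ℝ) :=
  proj1 '' convexHull ℝ
    {y : Fin (d + 1) → ℝ | ∃ m : Fin (d + 1) →₀ ℕ,
      MvPolynomial.monomial m (1 : 𝕜) ∈ JIdeal 𝕜 K h p ∧ (∑ j, m j) = p * h ∧
      y = fun j => (m j : ℝ)}

lemma nonneg_and_sum_le_of_suitableDeg {d : ℕ} {K : Set (Fin d → ℝ)} {h : ℕ}
    (hh : SuitableDeg K h) {x : Fin d → ℝ} (hx : x ∈ K) :
    (∀ j, 0 ≤ x j) ∧ ∑ j, x j ≤ h := by
  obtain ⟨y, ⟨hy, hy0⟩, rfl⟩ := hh.2 hx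
  refine ⟨fun j => hy0 _, ?_⟩
  have hy' : ∑ i, y i = (h : ℝ) := hy
  rw [Fin.sum_univ_castSucc] at hy'
  have := hy0 (Fin.last d)
  simp only [proj1]
  linarith

lemma monomial_mem_JIdeal_iff (𝕜 : Type*) [Field 𝕜] {d : ℕ} {K : Set (Fin d → ℝ)} {h p : ℕ}
    (hp : 0 < p) {m : Fin (d + 1) →₀ ℕ} (hm : ∑ j, m j = p * h) :
    MvPolynomial.monomial m (1 : 𝕜) ∈ JIdeal 𝕜 K h p ↔
      (fun i => (m i : ℝ)) ∈ coneBody K h := by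
  classical
  rw [JIdeal, MvPolynomial.mem_ideal_span_monomial_image]
  simp only [MvPolynomial.support_monomial, one_ne_zero, if_false, Finset.mem_singleton,
    forall_eq]
  constructor
  · rintro ⟨n, ⟨hn, hns⟩, hle⟩
    have hnm : n = m := by
      ext j
      exact (Finset.sum_eq_sum_iff_of_le (fun i _ => hle i)).1 (hns.trans hm.symm) j
        (Finset.mem_univ j)
    exact hnm ▸ hn.1
  · intro hc
    exact ⟨m, ⟨⟨hc, p, hp, hm⟩, hm⟩, le_rfl⟩

lemma KPoly_eq_convexHull (𝕜 : Type*) [Field 𝕜] {d : ℕ} (K : Set (Fin d → ℝ)) (h p : ℕ) :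
    KPoly 𝕜 K h p = convexHull ℝ (proj1 '' {y : Fin (d + 1) → ℝ | ∃ m : Fin (d + 1) →₀ ℕ,
      MvPolynomial.monomial m (1 : 𝕜) ∈ JIdeal 𝕜 K h p ∧ (∑ j, m j) = p * h ∧
      y = fun j => (m j : ℝ)}) :=
  (LinearMap.funLeft ℝ ℝ (Fin.castSucc : Fin d → Fin (d + 1))).image_convexHull _

lemma KPoly_subset_smul (𝕜 : Type*) [Field 𝕜] {d : ℕ} {K : Set (Fin d → ℝ)} {h p : ℕ}
    (hK : Convex ℝ K) (hh : 0 < h) (hp : 0 < p) : KPoly 𝕜 K h p ⊆ (p : ℝ) • K := by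
  rw [KPoly_eq_convexHull]
  refine convexHull_min ?_ (hK.smul _)
  rintro _ ⟨_, ⟨m, hm, hs, rfl⟩, rfl⟩
  obtain ⟨t, -, y, ⟨hyK, hys⟩, hy⟩ := (monomial_mem_JIdeal_iff 𝕜 hp hs).1 hm
  have hsum : ∑ i, (m i : ℝ) = t * ∑ i, y i := by
    rw [Finset.mul_sum]
    exact Finset.sum_congr rfl fun i _ => congrFun hy i
  have hs' : ∑ i, (m i : ℝ) = p * h := by exact_mod_cast hs
  rw [hys, hs'] at hsum
  have ht : t = p := (mul_right_cancel₀ (by positivity) hsum).symm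
  subst ht
  exact ⟨proj1 y, hyK, by rw [hy]; rfl⟩

lemma intCast_mem_KPoly (𝕜 : Type*) [Field 𝕜] {d : ℕ} {K : Set (Fin d → ℝ)} {h p : ℕ}
    (hh : SuitableDeg K h) (hp : 0 < p) {z : Fin d → ℤ}
    (hz : (fun j => (z j : ℝ)) ∈ (p : ℝ) • K) : (fun j => (z j : ℝ)) ∈ KPoly 𝕜 K h p := by
  obtain ⟨x, hx, hxz⟩ := hz
  have hxz' : ∀ j, (p : ℝ) * x j = z j := fun j => congrFun hxz j
  obtain ⟨hx0, hxs⟩ := nonneg_and_sum_le_of_suitableDeg hh hx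
  have hz0 : ∀ j, 0 ≤ z j := fun j => by
    have : (0 : ℝ) ≤ z j := hxz' j ▸ mul_nonneg (Nat.cast_nonneg p) (hx0 j)
    exact_mod_cast this
  lift z to Fin d → ℕ using hz0
  have hsle : ∑ j, z j ≤ p * h := by
    have : ∑ j, (z j : ℝ) ≤ p * h := by
      calc ∑ j, (z j : ℝ) = p * ∑ j, x j := by
            rw [Finset.mul_sum]
            exact Finset.sum_congr rfl fun j _ => by rw [hxz' j]; simp
        _ ≤ p * h := by gcongr
    exact_mod_cast this
  rw [KPoly_eq_convexHull]
  apply subset_convexHull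
  set m : Fin (d + 1) →₀ ℕ := Finsupp.equivFunOnFinite.symm (Fin.snoc z (p * h - ∑ j, z j))
    with hm
  have hm1 : ∀ j : Fin d, m j.castSucc = z j := fun j => by simp [hm]
  have hm2 : m (Fin.last d) = p * h - ∑ j, z j := by simp [hm]
  have hms : ∑ j, m j = p * h := by
    rw [Fin.sum_univ_castSucc, hm2]
    simp only [hm1]
    omega
  refine ⟨fun j => (m j : ℝ), ⟨m, (monomial_mem_JIdeal_iff 𝕜 hp hms).2 ?_, hms, rfl⟩, ?_⟩
  · have hp' : (p : ℝ) ≠ 0 := by positivity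
    refine ⟨p, by positivity, fun j => (p : ℝ)⁻¹ * m j, ⟨?_, ?_⟩, ?_⟩
    · convert hx using 1
      funext j
      have := hxz' j
      simp only [proj1, hm1]
      push_cast at this
      rw [← this, inv_mul_cancel_left₀ hp']
    · rw [← Finset.mul_sum, inv_mul_eq_iff_eq_mul₀ hp']
      exact_mod_cast hms
    · funext j
      simp [hp']
  · funext j
    simp [proj1, hm1]

/-- A real point lies in the convex hull of the integer points at distance at most one. -/
lemma mem_convexHull_intCast_of_dist_le_one {d : ℕ} (w : Fin d → ℝ) :
    w ∈ convexHull ℝ {v | ∃ z : Fin d → ℤ, v = (fun j => (z j : ℝ)) ∧ dist v w ≤ 1} := by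
  have hw : w ∈ convexHull ℝ (Set.univ.pi fun j : Fin d =>
      ({(⌊w j⌋ : ℝ), (⌊w j⌋ : ℝ) + 1} : Set ℝ)) := by
    rw [convexHull_pi]
    intro j _
    change w j ∈ convexHull ℝ {(⌊w j⌋ : ℝ), (⌊w j⌋ : ℝ) + 1}
    rw [convexHull_pair, segment_eq_Icc (by linarith)]
    exact ⟨Int.floor_le _, (Int.lt_floor_add_one _).le⟩
  refine convexHull_mono (fun v hv => ?_) hw
  have hv' : ∀ j, ∃ z : ℤ, v j = z ∧ |v j - w j| ≤ 1 := fun j => by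
    have h1 := Int.floor_le (w j)
    have h2 := Int.lt_floor_add_one (w j)
    rcases hv j (Set.mem_univ j) with hj | hj
    · exact ⟨⌊w j⌋, hj, by rw [hj, abs_le]; constructor <;> linarith⟩
    · have hj' : v j = (⌊w j⌋ : ℝ) + 1 := hj
      exact ⟨⌊w j⌋ + 1, by rw [hj']; push_cast; rfl,
        by rw [hj', abs_le]; constructor <;> linarith⟩
  choose z hz hd using hv'
  refine ⟨z, funext hz, (dist_pi_le_iff zero_le_one).2 fun j => ?_⟩
  rw [Real.dist_eq]
  exact hd j

/-- A fixed interior homothetic copy of `K` is eventually contained in `p⁻¹ • K(p)`. -/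
lemma eventually_smul_homothety_subset_KPoly (𝕜 : Type*) [Field 𝕜] {d : ℕ}
    {K : Set (Fin d → ℝ)} {h : ℕ} (hK : Convex ℝ K) (hh : SuitableDeg K h)
    {x : Fin d → ℝ} (hx : x ∈ interior K) {ε : ℝ} (hε : 0 < ε) (hε1 : ε ≤ 1) :
    ∀ᶠ p : ℕ in atTop, (p : ℝ) • ((1 - ε) • K + {ε • x}) ⊆ KPoly 𝕜 K h p := by
  obtain ⟨δ, hδ, hball⟩ := Metric.isOpen_iff.1 isOpen_interior x hx
  obtain ⟨N, hN⟩ := exists_nat_gt (1 / (ε * δ))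
  filter_upwards [eventually_ge_atTop (max N 1)] with p hp
  have hp0 : 0 < p := lt_of_lt_of_le one_pos ((le_max_right _ _).trans hp)
  have hpR : (0 : ℝ) < p := by exact_mod_cast hp0
  have hpN : 1 < p * ε * δ := by
    have h1 : (N : ℝ) ≤ p := by exact_mod_cast (le_max_left _ _).trans hp
    have h2 := hN.trans_le h1
    rw [div_lt_iff₀ (by positivity)] at h2
    linarith
  rintro _ ⟨_, ⟨_, ⟨y, hy, rfl⟩, _, rfl, rfl⟩, rfl⟩
  have hconv : Convex ℝ (KPoly 𝕜 K h p) := by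
    rw [KPoly_eq_convexHull]
    exact convex_convexHull ℝ _
  refine convexHull_min ?_ hconv (mem_convexHull_intCast_of_dist_le_one _)
  rintro _ ⟨z, rfl, hz⟩
  refine intCast_mem_KPoly 𝕜 hh hp0 ?_
  set w : Fin d → ℝ := fun j => (z j : ℝ)
  set u : Fin d → ℝ := (p * ε)⁻¹ • (w - (p : ℝ) • ((1 - ε) • y + ε • x)) with hu
  have hpε : (p : ℝ) * ε ≠ 0 := by positivity
  have hu1 : ‖u‖ < δ := by
    rw [hu, norm_smul, norm_inv, Real.norm_of_nonneg (by positivity),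
      inv_mul_lt_iff₀ (by positivity)]
    rw [dist_eq_norm] at hz
    exact lt_of_le_of_lt hz hpN
  have hxu : x + u ∈ K := interior_subset (hball (by simpa [dist_eq_norm] using hu1))
  refine ⟨(1 - ε) • y + ε • (x + u), hK hy hxu (by linarith) hε.le (by ring), ?_⟩
  have hu2 : ((p : ℝ) * ε) • u = w - (p : ℝ) • ((1 - ε) • y + ε • x) := by
    rw [hu, smul_inv_smul₀ hpε]
  have : (p : ℝ) • ((1 - ε) • y + ε • (x + u)) =
      (p : ℝ) • ((1 - ε) • y + ε • x) + ((p : ℝ) * ε) • u := by module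
  change (p : ℝ) • ((1 - ε) • y + ε • (x + u)) = w
  rw [this, hu2]
  abel

/-- The Minkowski combination `λ₀ K₀ + ∑ λᵢ Aᵢ`. -/
def minkowskiComb {d r : ℕ} (lam : Fin (r + 1) → ℝ) (A : Fin r → Set (Fin d → ℝ)) :
    Set (Fin d → ℝ) :=
  lam 0 • stdK0 d + ∑ i : Fin r, lam i.succ • A i

lemma isCompact_stdK0 (d : ℕ) : IsCompact (stdK0 d) :=
  ((Set.finite_range _).insert 0).isCompact_convexHull ℝ

lemma isCompact_minkowskiComb {d r : ℕ} (lam : Fin (r + 1) → ℝ) {A : Fin r → Set (Fin d → ℝ)}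
    (hA : ∀ i, IsCompact (A i)) : IsCompact (minkowskiComb lam A) := by
  refine ((isCompact_stdK0 d).smul _).add ?_
  refine Finset.sum_induction _ IsCompact (fun _ _ => IsCompact.add) ?_
    fun i _ => (hA i).smul _
  exact isCompact_singleton

lemma smul_minkowskiComb {d r : ℕ} (t : ℝ) (lam : Fin (r + 1) → ℝ)
    (A : Fin r → Set (Fin d → ℝ)) :
    t • minkowskiComb lam A = minkowskiComb (t • lam) A := by
  simp only [minkowskiComb, smul_add, Finset.smul_sum, smul_smul, Pi.smul_apply, smul_eq_mul]

lemma volume_smul_toReal {d : ℕ} {t : ℝ} (ht : 0 ≤ t) (A : Set (Fin d → ℝ)) :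
    (volume (t • A)).toReal = t ^ d * (volume A).toReal := by
  rw [Measure.addHaar_smul_of_nonneg _ ht, ENNReal.toReal_mul,
    ENNReal.toReal_ofReal (by positivity)]
  simp

lemma smul_stdK0_homothety_subset {d : ℕ} {ε : ℝ} (hε : 0 ≤ ε) (hε1 : ε ≤ 1) :
    (1 - ε) • stdK0 d ⊆ stdK0 d := by
  rintro _ ⟨y, hy, rfl⟩
  exact (convex_convexHull ℝ _).smul_mem_of_zero_mem
    (subset_convexHull ℝ _ (Set.mem_insert _ _)) hy ⟨by linarith, by linarith⟩

lemma tendsto_volume_minkowskiComb_KPoly (𝕜 : Type*) [Field 𝕜] {d r : ℕ}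
    {K : Fin r → Set (Fin d → ℝ)} {h : Fin r → ℕ} (hK : ∀ i, IsConvexBody (K i))
    (hh : ∀ i, SuitableDeg (K i) (h i)) (lam : Fin (r + 1) → ℝ) :
    Tendsto (fun p : ℕ => (volume (lam 0 • stdK0 d +
        ∑ i : Fin r, (lam i.succ / (p : ℝ)) • KPoly 𝕜 (K i) (h i) p)).toReal) atTop
      (nhds ((volume (minkowskiComb lam K)).toReal)) := by
  have hfin : volume (minkowskiComb lam K) ≠ ⊤ :=
    (isCompact_minkowskiComb lam fun i => (hK i).2.1).measure_ne_top
  have hup : ∀ p : ℕ, 0 < p → lam 0 • stdK0 d +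
      ∑ i : Fin r, (lam i.succ / (p : ℝ)) • KPoly 𝕜 (K i) (h i) p ⊆ minkowskiComb lam K := by
    intro p hp
    refine Set.add_subset_add_left (Set.finsetSum_subset_finsetSum _ _ _ fun i _ => ?_)
    refine (Set.smul_set_mono (KPoly_subset_smul 𝕜 (hK i).1 (hh i).1 hp)).trans ?_
    rw [smul_smul, div_mul_cancel₀ _ (by positivity)]
  have hlow : ∀ ε : ℝ, 0 < ε → ε ≤ 1 → ∀ᶠ p : ℕ in atTop,
      (1 - ε) ^ d * (volume (minkowskiComb lam K)).toReal ≤ (volume (lam 0 • stdK0 d +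
        ∑ i : Fin r, (lam i.succ / (p : ℝ)) • KPoly 𝕜 (K i) (h i) p)).toReal := by
    intro ε hε hε1
    choose x hx using fun i => (hK i).2.2
    have hev := eventually_all.2 fun i =>
      eventually_smul_homothety_subset_KPoly 𝕜 (hK i).1 (hh i) (hx i) hε hε1
    filter_upwards [hev, eventually_gt_atTop 0] with p hp hp0
    have hsub : (1 - ε) • minkowskiComb lam K + {∑ i, lam i.succ • ε • x i} ⊆
        lam 0 • stdK0 d +
          ∑ i : Fin r, (lam i.succ / (p : ℝ)) • KPoly 𝕜 (K i) (h i) p := by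
      rw [minkowskiComb, smul_add, Finset.smul_sum, add_assoc, ← Set.finsetSum_singleton,
        ← Finset.sum_add_distrib]
      refine Set.add_subset_add ?_ (Set.finsetSum_subset_finsetSum _ _ _ fun i _ => ?_)
      · rw [smul_comm]
        exact Set.smul_set_mono (smul_stdK0_homothety_subset hε.le hε1)
      · refine Set.Subset.trans (Eq.subset ?_) (Set.smul_set_mono (hp i))
        have hp' : (p : ℝ) ≠ 0 := by positivity
        rw [smul_smul (lam i.succ / (p : ℝ)), div_mul_cancel₀ _ hp', smul_add,
          smul_comm (lam i.succ) (1 - ε) (K i), Set.smul_set_singleton]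
    calc (1 - ε) ^ d * (volume (minkowskiComb lam K)).toReal
        = (volume ((1 - ε) • minkowskiComb lam K + {∑ i, lam i.succ • ε • x i})).toReal := by
          rw [← volume_smul_toReal (by linarith), Set.add_singleton,
            Set.image_add_right, measure_preimage_add_right]
      _ ≤ _ := ENNReal.toReal_mono (measure_ne_top_of_subset (hup p hp0) hfin)
          (measure_mono hsub)
  rw [tendsto_order]
  refine ⟨fun a ha => ?_, fun a ha => ?_⟩
  · have hcont : Tendsto (fun ε : ℝ => (1 - ε) ^ d * (volume (minkowskiComb lam K)).toReal)
        (nhdsWithin 0 (Set.Ioi 0)) (nhds ((volume (minkowskiComb lam K)).toReal)) := by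
      have hc : Continuous fun ε : ℝ =>
          (1 - ε) ^ d * (volume (minkowskiComb lam K)).toReal := by fun_prop
      simpa using (hc.tendsto 0).mono_left nhdsWithin_le_nhds
    obtain ⟨ε, hεa, hε0, hε1⟩ := ((hcont.eventually (lt_mem_nhds ha)).and
      (Ioc_mem_nhdsGT (zero_lt_one' ℝ))).exists
    exact (hlow ε hε0 hε1).mono fun p hp => hεa.trans_le hp
  · filter_upwards [eventually_gt_atTop 0] with p hp
    exact (ENNReal.toReal_mono hfin (measure_mono (hup p hp))).trans_lt ha

lemma eval_bind₁_C_mul_X {σ : Type*} (s x : σ → ℝ) (P : MvPolynomial σ ℝ) :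
    eval x (bind₁ (fun i => C (s i) * X i) P) = eval (fun i => s i * x i) P := by
  rw [← MvPolynomial.aeval_eq_eval, ← MvPolynomial.aeval_eq_eval, aeval_bind₁]
  simp

lemma coeff_bind₁_C_mul_X {σ : Type*} (s : σ → ℝ) (P : MvPolynomial σ ℝ) (m : σ →₀ ℕ) :
    coeff m (bind₁ (fun i => C (s i) * X i) P) = (m.prod fun i k => s i ^ k) * coeff m P := by
  classical
  induction P using MvPolynomial.induction_on' with
  | monomial n a =>
    have : bind₁ (fun i => C (s i) * X i) (monomial n a) =
        monomial n (a * n.prod fun i k => s i ^ k) := by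
      rw [bind₁_monomial, MvPolynomial.monomial_eq, C_mul, mul_assoc]
      simp only [mul_pow, Finsupp.prod, Finset.prod_mul_distrib, map_prod, map_pow]
    rw [this, coeff_monomial, coeff_monomial]
    split_ifs with hnm
    · rw [hnm, mul_comm]
    · rw [mul_zero]
  | add p q hp hq => rw [map_add, coeff_add, coeff_add, hp, hq, mul_add]

lemma eq_of_eval_eq_of_nonneg {σ : Type*} {P Q : MvPolynomial σ ℝ}
    (hPQ : ∀ x : σ → ℝ, (∀ i, 0 ≤ x i) → eval x P = eval x Q) : P = Q :=
  MvPolynomial.funext_set (fun _ : σ => Set.Ici (0 : ℝ)) (fun _ => Set.Ici_infinite 0)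
    fun x hx => hPQ x fun i => hx i (Set.mem_univ i)

lemma isHomogeneous_of_eval_two_smul {σ : Type*} {P : MvPolynomial σ ℝ} {d : ℕ}
    (hP : ∀ x : σ → ℝ, (∀ i, 0 ≤ x i) → eval ((2 : ℝ) • x) P = 2 ^ d * eval x P) :
    P.IsHomogeneous d := by
  intro m hm
  have hpoly : bind₁ (fun i => C (2 : ℝ) * X i) P = C (2 ^ d) * P :=
    eq_of_eval_eq_of_nonneg fun x hx => by
      rw [eval_bind₁_C_mul_X (fun _ => 2), eval_mul, eval_C]
      exact hP x hx
  have hc := congrArg (coeff m) hpoly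
  rw [coeff_bind₁_C_mul_X (fun _ => 2), coeff_C_mul] at hc
  have h2 := mul_right_cancel₀ hm hc
  rw [Finsupp.prod, Finset.prod_pow_eq_pow_sum] at h2
  have := (pow_right_injective₀ (by norm_num : (0 : ℝ) < 2) (by norm_num)) h2
  simpa [Finsupp.weight_apply, Finsupp.sum] using this

/-- For real polynomials of bounded degree, pointwise convergence on the nonnegative orthant
implies convergence of the coefficients. -/
lemma tendsto_coeff_of_tendsto_eval {σ ι : Type*} [Finite σ] {l : Filter ι} {N : ℕ}
    {F : ι → MvPolynomial σ ℝ} {G : MvPolynomial σ ℝ}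
    (hF : ∀ᶠ n in l, F n ∈ restrictTotalDegree σ ℝ N) (hG : G ∈ restrictTotalDegree σ ℝ N)
    (hFG : ∀ x : σ → ℝ, (∀ i, 0 ≤ x i) →
      Tendsto (fun n => eval x (F n)) l (nhds (eval x G))) (m : σ →₀ ℕ) :
    Tendsto (fun n => coeff m (F n)) l (nhds (coeff m G)) := by
  set W := restrictTotalDegree σ ℝ N
  let ev : {x : σ → ℝ // ∀ i, 0 ≤ x i} → W →ₗ[ℝ] ℝ :=
    fun x => (aeval (R := ℝ) x.1).toLinearMap ∘ₗ W.subtype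
  let cf : W →ₗ[ℝ] ℝ := lcoeff ℝ m ∘ₗ W.subtype
  have hspan : cf ∈ Submodule.span ℝ (Set.range ev) := by
    refine FiniteDimensional.mem_span_of_iInf_ker_le_ker fun P hP => ?_
    have hP0 : (P : MvPolynomial σ ℝ) = 0 := eq_of_eval_eq_of_nonneg fun x hx => by
      have := (Submodule.mem_iInf _).1 hP ⟨x, hx⟩
      simpa [ev, LinearMap.mem_ker, MvPolynomial.aeval_eq_eval] using this
    have : P = 0 := Subtype.ext hP0
    rw [this]
    exact Submodule.zero_mem _
  have key : ∀ L ∈ Submodule.span ℝ (Set.range ev), ∀ F' : ι → W,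
      (∀ᶠ n in l, (F' n : MvPolynomial σ ℝ) = F n) →
      Tendsto (fun n => L (F' n)) l (nhds (L ⟨G, hG⟩)) := by
    intro L hL F' hF'
    induction hL using Submodule.span_induction with
    | mem L hL =>
      obtain ⟨x, rfl⟩ := hL
      have := hFG x.1 x.2
      refine Tendsto.congr' ?_ this
      filter_upwards [hF'] with n hn
      simp [ev, hn, MvPolynomial.aeval_eq_eval]
    | zero => simpa using tendsto_const_nhds
    | add L M _ _ hL hM => simpa using hL.add hM
    | smul a L _ hL => simpa using hL.const_mul a
  classical
  let F' : ι → W := fun n => if hn : F n ∈ W then ⟨F n, hn⟩ else 0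
  have hF' : ∀ᶠ n in l, (F' n : MvPolynomial σ ℝ) = F n := by
    filter_upwards [hF] with n hn
    simp [F', hn]
  refine Tendsto.congr' ?_ (key cf hspan F' hF')
  filter_upwards [hF'] with n hn
  simp [cf, hn]

/-- **Approximation of mixed volumes by the lattice polytopes `K_i(p)`.**
For every `λ ∈ ℝ^{r+1}_{≥0}`,
`Vol_d(λ₀K₀ + (λ₁/p)K₁(p) + ⋯ + (λ_r/p)K_r(p)) → Vol_d(λ₀K₀ + λ₁K₁ + ⋯ + λ_rK_r)` as
`p → ∞`; equivalently, for each `(d₀,𝐝)` with `d₀+|𝐝|=d`, the mixed volumes of `d₀` copies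
of `K₀` and `d_i` copies of `K_i(p)`, normalized by `p^{|𝐝|}`, converge to the mixed volume
of `d₀` copies of `K₀` and `d_i` copies of `K_i` (mixed volumes being the coefficients of
the respective volume polynomials `Q_p` and `Q`). -/
theorem statement17 {𝕜 : Type*} [Field 𝕜] (d r : ℕ)
    (K : Fin r → Set (Fin d → ℝ)) (h : Fin r → ℕ)
    (hK : ∀ i, IsConvexBody (K i) ∧ K i ⊆ {x | ∀ j, 0 ≤ x j})
    (hh : ∀ i, SuitableDeg (K i) (h i))
    (Qp : ℕ → MvPolynomial (Fin (r + 1)) ℝ)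
    (hQp : ∀ p : ℕ, 0 < p → ∀ lam : Fin (r + 1) → ℝ, (∀ i, 0 ≤ lam i) →
      MvPolynomial.eval lam (Qp p) =
        (MeasureTheory.volume
          (lam 0 • stdK0 d + ∑ i : Fin r, lam i.succ • KPoly 𝕜 (K i) (h i) p)).toReal)
    (Q : MvPolynomial (Fin (r + 1)) ℝ)
    (hQ : ∀ lam : Fin (r + 1) → ℝ, (∀ i, 0 ≤ lam i) →
      MvPolynomial.eval lam Q =
        (MeasureTheory.volume (lam 0 • stdK0 d + ∑ i : Fin r, lam i.succ • K i)).toReal) :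
    (∀ lam : Fin (r + 1) → ℝ, (∀ i, 0 ≤ lam i) →
      Tendsto
        (fun p : ℕ =>
          (MeasureTheory.volume
            (lam 0 • stdK0 d +
              ∑ i : Fin r, (lam i.succ / (p : ℝ)) • KPoly 𝕜 (K i) (h i) p)).toReal)
        atTop
        (nhds ((MeasureTheory.volume
          (lam 0 • stdK0 d + ∑ i : Fin r, lam i.succ • K i)).toReal))) ∧
    ∀ (d0 : ℕ) (D : Fin r → ℕ), d0 + ∑ i, D i = d →
      Tendsto
        (fun p : ℕ =>
          ((Nat.factorial d0 * ∏ i, Nat.factorial (D i) : ℕ) : ℝ) *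
              (Qp p).coeff (Finsupp.equivFunOnFinite.symm (Fin.cons d0 D)) /
            (p : ℝ) ^ (∑ i, D i))
        atTop
        (nhds (((Nat.factorial d0 * ∏ i, Nat.factorial (D i) : ℕ) : ℝ) *
          Q.coeff (Finsupp.equivFunOnFinite.symm (Fin.cons d0 D)))) := by
  have hvol := fun lam : Fin (r + 1) → ℝ =>
    tendsto_volume_minkowskiComb_KPoly 𝕜 (fun i => (hK i).1) hh lam
  refine ⟨fun lam _ => hvol lam, fun d0 D _ => ?_⟩
  have hhom : ∀ p : ℕ, 0 < p → (Qp p).IsHomogeneous d := fun p hp => by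
    refine isHomogeneous_of_eval_two_smul fun x hx => ?_
    rw [hQp p hp ((2 : ℝ) • x) fun i => mul_nonneg zero_le_two (hx i), hQp p hp x hx,
      ← volume_smul_toReal zero_le_two]
    exact congrArg (fun A => (volume A).toReal)
      (smul_minkowskiComb 2 x fun i => KPoly 𝕜 (K i) (h i) p).symm
  let s : ℕ → Fin (r + 1) → ℝ := fun p => Fin.cons 1 fun _ => (p : ℝ)⁻¹
  let F : ℕ → MvPolynomial (Fin (r + 1)) ℝ := fun p => bind₁ (fun i => C (s p i) * X i) (Qp p)
  have hF : ∀ᶠ p in atTop, F p ∈ restrictTotalDegree (Fin (r + 1)) ℝ (max d Q.totalDegree) := by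
    filter_upwards [eventually_gt_atTop 0] with p hp
    rw [mem_restrictTotalDegree]
    refine le_trans (IsHomogeneous.totalDegree_le fun m hm => ?_) (le_max_left _ _)
    rw [coeff_bind₁_C_mul_X] at hm
    exact hhom p hp (right_ne_zero_of_mul hm)
  have hG : Q ∈ restrictTotalDegree (Fin (r + 1)) ℝ (max d Q.totalDegree) := by
    rw [mem_restrictTotalDegree]
    exact le_max_right _ _
  have hFG : ∀ x : Fin (r + 1) → ℝ, (∀ i, 0 ≤ x i) →
      Tendsto (fun p => eval x (F p)) atTop (nhds (eval x Q)) := by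
    intro x hx
    rw [hQ x hx]
    refine Tendsto.congr' ?_ (hvol x)
    filter_upwards [eventually_gt_atTop 0] with p hp
    rw [eval_bind₁_C_mul_X, hQp p hp]
    · simp only [s, Fin.cons_zero, Fin.cons_succ, one_mul, div_eq_inv_mul]
    · intro i
      refine mul_nonneg ?_ (hx i)
      refine Fin.cases ?_ (fun j => ?_) i <;> simp [s]
  have hlim := (tendsto_coeff_of_tendsto_eval hF hG hFG
    (Finsupp.equivFunOnFinite.symm (Fin.cons d0 D))).const_mul
      ((Nat.factorial d0 * ∏ i, Nat.factorial (D i) : ℕ) : ℝ)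
  refine hlim.congr fun p => ?_
  rw [coeff_bind₁_C_mul_X, Finsupp.prod_fintype _ _ fun _ => pow_zero _, Fin.prod_univ_succ]
  simp only [s, Finsupp.equivFunOnFinite_symm_apply_apply, Fin.cons_zero, Fin.cons_succ, one_pow,
    one_mul, inv_pow, Finset.prod_pow_eq_pow_sum, Finset.prod_inv_distrib]
  ring
end
end
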